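/- arXiv:1311.6525 — 5 statements merged into one kernel-verified Lean document; each statement's English description precedes it below -/
import Mathlib

section
/- Let N ≥ 1, m > 1, and k ≥ 1 an integer. Define the polynomial ψ : ℝ^N → ℝ by ψ(x) = Σ_{j=0}^{k} [(-k)_j (1/(m-1) + N/2 - 1 + k)_j / ((N/2)_j · j!)] · |x|^{2j}, where (s)_j = s(s+1)⋯(s+j-1) denotes the Pochhammer symbol. Then for every x in the open unit ball B_1 ⊂ ℝ^N, (H_E ψ)(x) = λ_{0k} ψ(x) with λ_{0k} = 2k + 2k(k + N/2 - 1)(m-1), and consequently ((H_E² + N(m-1)H_E)ψ)(x) = (λ_{0k}² + N(m-1)λ_{0k}) ψ(x), i.e. ψ is an eigenfunction of the fourth-order displacement Hessian H_I = (H_E² + N(m-1)H_E)/(1 + N(m-1)) with eigenvalue μ_{0k} = (λ_{0k}² + N(m-1)λ_{0k})/(1 + N(m-1)). -/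
open MeasureTheory Real Filter ENNReal

noncomputable section

/-- The `i`-th partial derivative of `f` at `x`. -/
def pdv (N : ℕ) (f : EuclideanSpace ℝ (Fin N) → ℝ) (i : Fin N)
    (x : EuclideanSpace ℝ (Fin N)) : ℝ :=
  fderiv ℝ f x (EuclideanSpace.single i 1)

/-- The Laplacian of `f` at `x`. -/
def lap (N : ℕ) (f : EuclideanSpace ℝ (Fin N) → ℝ)
    (x : EuclideanSpace ℝ (Fin N)) : ℝ :=
  ∑ i, pdv N (pdv N f i) i x

/-- The porous medium displacement Hessian
`(H_E ψ)(x) = -((m-1)/2)(1-|x|²)Δψ(x) + x·∇ψ(x)`. -/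
def HE (N : ℕ) (m : ℝ) (f : EuclideanSpace ℝ (Fin N) → ℝ)
    (x : EuclideanSpace ℝ (Fin N)) : ℝ :=
  -((m - 1) / 2) * (1 - ‖x‖ ^ 2) * lap N f x + ∑ i, x i * pdv N f i x

theorem hasFDerivAt_eval_norm_sq {N : ℕ} (p : Polynomial ℝ) (x : EuclideanSpace ℝ (Fin N)) :
    HasFDerivAt (fun y : EuclideanSpace ℝ (Fin N) => p.eval (‖y‖ ^ 2))
      (p.derivative.eval (‖x‖ ^ 2) • ((2 : ℝ) • innerSL ℝ x)) x := by
  have h := (hasStrictFDerivAt_norm_sq x).hasFDerivAt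
  have h2 := (p.hasDerivAt (‖x‖ ^ 2)).comp_hasFDerivAt x h
  rwa [← ofNat_smul_eq_nsmul ℝ] at h2

theorem pdv_eval_norm_sq {N : ℕ} (p : Polynomial ℝ) (i : Fin N) :
    pdv N (fun y => p.eval (‖y‖ ^ 2)) i =
      fun x => 2 * x i * p.derivative.eval (‖x‖ ^ 2) := by
  funext x
  rw [pdv, (hasFDerivAt_eval_norm_sq p x).fderiv]
  simp [EuclideanSpace.inner_single_right]
  ring

theorem pdv_pdv_eval_norm_sq {N : ℕ} (p : Polynomial ℝ) (i : Fin N)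
    (x : EuclideanSpace ℝ (Fin N)) :
    pdv N (pdv N (fun y => p.eval (‖y‖ ^ 2)) i) i x =
      2 * p.derivative.eval (‖x‖ ^ 2) +
        4 * x i ^ 2 * p.derivative.derivative.eval (‖x‖ ^ 2) := by
  have hx : HasFDerivAt (fun y : EuclideanSpace ℝ (Fin N) => 2 * y i)
      ((2 : ℝ) • (EuclideanSpace.proj i : EuclideanSpace ℝ (Fin N) →L[ℝ] ℝ)) x :=
    (EuclideanSpace.proj i : EuclideanSpace ℝ (Fin N) →L[ℝ] ℝ).hasFDerivAt.const_mul 2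
  rw [pdv_eval_norm_sq, pdv, (hx.fun_mul (hasFDerivAt_eval_norm_sq p.derivative x)).fderiv]
  simp [EuclideanSpace.inner_single_right]
  ring

theorem HE_eval_norm_sq {N : ℕ} (m : ℝ) (p : Polynomial ℝ) (x : EuclideanSpace ℝ (Fin N)) :
    HE N m (fun y => p.eval (‖y‖ ^ 2)) x =
      -((m - 1) / 2) * (1 - ‖x‖ ^ 2) *
          (2 * N * p.derivative.eval (‖x‖ ^ 2) +
            4 * ‖x‖ ^ 2 * p.derivative.derivative.eval (‖x‖ ^ 2)) +
        2 * ‖x‖ ^ 2 * p.derivative.eval (‖x‖ ^ 2) := by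
  have hs : ∑ i, x i ^ 2 = ‖x‖ ^ 2 := by simp [EuclideanSpace.norm_sq_eq]
  have h1 : lap N (fun y => p.eval (‖y‖ ^ 2)) x =
      2 * N * p.derivative.eval (‖x‖ ^ 2) +
        4 * ‖x‖ ^ 2 * p.derivative.derivative.eval (‖x‖ ^ 2) := by
    simp only [lap, pdv_pdv_eval_norm_sq, Finset.sum_add_distrib, ← Finset.sum_mul,
      ← Finset.mul_sum, hs, Finset.sum_const, Finset.card_univ, Fintype.card_fin, nsmul_eq_mul]
    ring
  have h2 : ∑ i, x i * pdv N (fun y => p.eval (‖y‖ ^ 2)) i x =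
      2 * ‖x‖ ^ 2 * p.derivative.eval (‖x‖ ^ 2) := by
    calc ∑ i, x i * pdv N (fun y => p.eval (‖y‖ ^ 2)) i x
        = ∑ i, 2 * x i ^ 2 * p.derivative.eval (‖x‖ ^ 2) := by
          refine Finset.sum_congr rfl fun i _ => ?_
          rw [pdv_eval_norm_sq]
          ring
      _ = 2 * ‖x‖ ^ 2 * p.derivative.eval (‖x‖ ^ 2) := by
          rw [← Finset.sum_mul, ← Finset.mul_sum, hs]
  rw [HE, h1, h2]

theorem HE_const_mul_eval_norm_sq {N : ℕ} (m a : ℝ) (p : Polynomial ℝ)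
    (x : EuclideanSpace ℝ (Fin N)) :
    HE N m (fun y => a * p.eval (‖y‖ ^ 2)) x = a * HE N m (fun y => p.eval (‖y‖ ^ 2)) x := by
  have h : (fun y : EuclideanSpace ℝ (Fin N) => a * p.eval (‖y‖ ^ 2)) =
      fun y => (Polynomial.C a * p).eval (‖y‖ ^ 2) := by simp
  rw [h, HE_eval_norm_sq, HE_eval_norm_sq]
  simp
  ring

/-- The coefficients of the hypergeometric polynomial `₂F₁(-k, a; b; s)`. -/
def hypergeomCoeff (k : ℕ) (a b : ℝ) (j : ℕ) : ℝ :=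
  ((ascPochhammer ℝ j).eval (-(k : ℝ)) * (ascPochhammer ℝ j).eval a) /
    ((ascPochhammer ℝ j).eval b * (Nat.factorial j : ℝ))

theorem hypergeomCoeff_succ (k : ℕ) (a : ℝ) {b : ℝ} (hb : 0 < b) (j : ℕ) :
    (j + 1) * (b + j) * hypergeomCoeff k a b (j + 1) =
      (j - k) * (a + j) * hypergeomCoeff k a b j := by
  have h1 := (ascPochhammer_pos j b hb).ne'
  have h2 : b + j ≠ 0 := by positivity
  have h3 : (Nat.factorial j : ℝ) ≠ 0 := by positivity
  have h4 : (j : ℝ) + 1 ≠ 0 := by positivity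
  simp only [hypergeomCoeff, ascPochhammer_succ_eval, Nat.factorial_succ, Nat.cast_mul,
    Nat.cast_succ]
  field_simp
  ring

/-- The hypergeometric polynomial `₂F₁(-k, a; b; s)`. -/
def hypergeomPoly (k : ℕ) (a b : ℝ) : Polynomial ℝ :=
  ∑ j ∈ Finset.range (k + 1), Polynomial.C (hypergeomCoeff k a b j) * Polynomial.X ^ j

theorem hypergeomPoly_ode (k : ℕ) (a : ℝ) {b : ℝ} (hb : 0 < b) (s : ℝ) :
    s * (1 - s) * (hypergeomPoly k a b).derivative.derivative.eval s +
        (b - (a - k + 1) * s) * (hypergeomPoly k a b).derivative.eval s +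
      k * a * (hypergeomPoly k a b).eval s = 0 := by
  have hterm : ∀ j : ℕ,
      s * (1 - s) * ((Polynomial.X ^ j : Polynomial ℝ).derivative.derivative.eval s) +
          (b - (a - k + 1) * s) * ((Polynomial.X ^ j : Polynomial ℝ).derivative.eval s) +
        k * a * s ^ j = j * (b + j - 1) * s ^ (j - 1) - (j - k) * (a + j) * s ^ j := by
    intro j
    rcases j with _ | _ | j
    · simp
    · simp
      ring
    · simp [Polynomial.derivative_mul]
      ring
  have hsum : s * (1 - s) * (hypergeomPoly k a b).derivative.derivative.eval s +
        (b - (a - k + 1) * s) * (hypergeomPoly k a b).derivative.eval s +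
      k * a * (hypergeomPoly k a b).eval s =
      ∑ j ∈ Finset.range (k + 1), hypergeomCoeff k a b j *
        (j * (b + j - 1) * s ^ (j - 1) - (j - k) * (a + j) * s ^ j) := by
    simp only [hypergeomPoly, Polynomial.derivative_sum, Polynomial.eval_finsetSum,
      Finset.mul_sum, ← Finset.sum_add_distrib, Polynomial.derivative_C_mul,
      Polynomial.eval_C_mul]
    refine Finset.sum_congr rfl fun j _ => ?_
    rw [← hterm j, Polynomial.eval_pow, Polynomial.eval_X]
    ring
  rw [hsum]
  simp only [mul_sub, Finset.sum_sub_distrib]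
  rw [Finset.sum_range_succ', Finset.sum_range_succ, sub_eq_zero]
  simp only [Nat.cast_zero, sub_self, zero_mul, mul_zero, add_zero]
  refine Finset.sum_congr rfl fun j _ => ?_
  have h := hypergeomCoeff_succ k a hb j
  simp only [Nat.add_sub_cancel, Nat.cast_succ]
  linear_combination s ^ j * h

/-- For `N ≥ 1`, `m > 1`, `k ≥ 1`, the radial polynomial
`ψ(x) = Σ_{j=0}^{k} [(-k)_j (1/(m-1) + N/2 - 1 + k)_j / ((N/2)_j j!)] |x|^{2j}`
is an eigenfunction of `H_E` on the unit ball with eigenvalue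
`λ_{0k} = 2k + 2k(k + N/2 - 1)(m-1)`, and hence of
`H_I = (H_E² + N(m-1)H_E)/(1 + N(m-1))` with eigenvalue
`μ_{0k} = (λ_{0k}² + N(m-1)λ_{0k})/(1 + N(m-1))`. -/
theorem stmt0 (N : ℕ) (hN : 1 ≤ N) (m : ℝ) (hm : 1 < m) (k : ℕ) (hk : 1 ≤ k)
    (ψ : EuclideanSpace ℝ (Fin N) → ℝ)
    (hψ : ψ = fun x => ∑ j ∈ Finset.range (k + 1),
      ((ascPochhammer ℝ j).eval (-(k : ℝ)) *
          (ascPochhammer ℝ j).eval (1 / (m - 1) + (N : ℝ) / 2 - 1 + (k : ℝ))) /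
        ((ascPochhammer ℝ j).eval ((N : ℝ) / 2) * (Nat.factorial j : ℝ)) *
        ‖x‖ ^ (2 * j))
    (lam : ℝ) (hlam : lam = 2 * (k : ℝ) + 2 * (k : ℝ) * ((k : ℝ) + (N : ℝ) / 2 - 1) * (m - 1))
    (μ : ℝ) (hμ : μ = (lam ^ 2 + (N : ℝ) * (m - 1) * lam) / (1 + (N : ℝ) * (m - 1))) :
    ∀ x : EuclideanSpace ℝ (Fin N), ‖x‖ < 1 →
      HE N m ψ x = lam * ψ x ∧
      HE N m (HE N m ψ) x + (N : ℝ) * (m - 1) * HE N m ψ x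
        = (lam ^ 2 + (N : ℝ) * (m - 1) * lam) * ψ x ∧
      (HE N m (HE N m ψ) x + (N : ℝ) * (m - 1) * HE N m ψ x) / (1 + (N : ℝ) * (m - 1))
        = μ * ψ x := by
  have hb : (0 : ℝ) < (N : ℝ) / 2 := by positivity
  have hm' : m - 1 ≠ 0 := (sub_pos.2 hm).ne'
  set a : ℝ := 1 / (m - 1) + (N : ℝ) / 2 - 1 + (k : ℝ) with ha
  have ham : (m - 1) * a = 1 + (m - 1) * ((N : ℝ) / 2 - 1 + k) := by
    rw [ha]
    field_simp
    ring
  set p := hypergeomPoly k a ((N : ℝ) / 2) with hp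
  have hψp : ψ = fun x => p.eval (‖x‖ ^ 2) := by
    rw [hψ]
    funext x
    simp [hp, hypergeomPoly, hypergeomCoeff, Polynomial.eval_finsetSum, pow_mul]
  have hE : HE N m ψ = fun x => lam * ψ x := by
    funext x
    have hode := hypergeomPoly_ode k a hb (‖x‖ ^ 2)
    rw [← hp] at hode
    rw [hψp, HE_eval_norm_sq, hlam]
    linear_combination (-2 * (m - 1)) * hode +
      (2 * k * p.eval (‖x‖ ^ 2) - 2 * ‖x‖ ^ 2 * p.derivative.eval (‖x‖ ^ 2)) * ham
  have hE2 : ∀ x, HE N m (HE N m ψ) x = lam ^ 2 * ψ x := by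
    intro x
    have h : HE N m (fun y => lam * ψ y) x = lam * HE N m ψ x := by
      rw [hψp]
      exact HE_const_mul_eval_norm_sq m lam p x
    rw [hE, h, hE]
    ring
  intro x _
  have hEx : HE N m ψ x = lam * ψ x := congrFun hE x
  refine ⟨hEx, ?_, ?_⟩
  · rw [hE2, hEx]
    ring
  · rw [hE2, hEx, hμ]
    ring
end
end

section
/- Let V be a real vector space, T : V → V a linear map, c ≥ 0 and μ > 0 real numbers. Set ε = c/2 + √(μ(1+c) + c²/4) and λ = μ(1+c)/ε. Then ε > 0, λ > 0, ε - λ = c and ελ = μ(1+c); moreover, for every ψ ∈ V satisfying T²ψ + cTψ = μ(1+c)ψ, the vector φ = Tψ + εψ satisfies Tφ = λφ. In particular, if φ ≠ 0 then λ is an eigenvalue of T. -/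
/-- Let `V` be a real vector space, `T : V → V` linear, `c ≥ 0`, `μ > 0`.
With `ε = c/2 + √(μ(1+c) + c²/4)` and `λ = μ(1+c)/ε` one has `ε > 0`, `λ > 0`,
`ε - λ = c`, `ελ = μ(1+c)`; and every `ψ` with `T²ψ + cTψ = μ(1+c)ψ` yields
`φ = Tψ + εψ` with `Tφ = λφ`, so `λ` is an eigenvalue of `T` whenever `φ ≠ 0`. -/
theorem stmt2 (V : Type*) [AddCommGroup V] [Module ℝ V] (T : V →ₗ[ℝ] V)
    (c μ : ℝ) (hc : 0 ≤ c) (hμ : 0 < μ)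
    (ε lam : ℝ)
    (hε : ε = c / 2 + Real.sqrt (μ * (1 + c) + c ^ 2 / 4))
    (hlam : lam = μ * (1 + c) / ε) :
    0 < ε ∧ 0 < lam ∧ ε - lam = c ∧ ε * lam = μ * (1 + c) ∧
    ∀ ψ : V, T (T ψ) + c • T ψ = (μ * (1 + c)) • ψ →
      T (T ψ + ε • ψ) = lam • (T ψ + ε • ψ) ∧
      (T ψ + ε • ψ ≠ 0 → Module.End.HasEigenvalue (T : Module.End ℝ V) lam) := by
  have hp : 0 < μ * (1 + c) := by positivity
  have hε_pos : 0 < ε := by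
    rw [hε]
    positivity
  have hquad : ε ^ 2 - c * ε = μ * (1 + c) := by
    have hsq := Real.sq_sqrt (show 0 ≤ μ * (1 + c) + c ^ 2 / 4 by positivity)
    rw [hε]
    linear_combination hsq
  have hprod : ε * lam = μ * (1 + c) := by
    rw [hlam]
    field_simp
  have hdiff : ε - lam = c := by
    apply mul_left_cancel₀ hε_pos.ne'
    linear_combination hquad - hprod
  refine ⟨hε_pos, hlam ▸ div_pos hp hε_pos, hdiff, hprod, fun ψ hψ => ?_⟩
  have heig : T (T ψ + ε • ψ) = lam • (T ψ + ε • ψ) := by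
    rw [← hprod, ← hdiff] at hψ
    rw [map_add, map_smul]
    linear_combination (norm := module) hψ
  exact ⟨heig, fun hne => Module.End.hasEigenvalue_of_hasEigenvector
    (Module.End.hasEigenvector_iff.mpr ⟨Module.End.mem_eigenspace_iff.mpr heig, hne⟩)⟩
end

section
/- Let N ≥ 1, m > 1, and let ψ, φ : ℝ^N → ℝ be smooth on a neighborhood of the closed unit ball. With v_*(x) = ((m-1)/(2m)·(1-|x|²))^{1/(m-1)} for |x| ≤ 1 and (H_E ψ)(x) = -((m-1)/2)(1-|x|²)Δψ(x) + x·∇ψ(x), one has ∫_{B_1} v_* ∇φ·∇(H_E² ψ) dx = ∫_{B_1} v_* ∇(H_E φ)·∇(H_E ψ) dx. In particular, taking φ = ψ, the operator H_E² is symmetric and nonnegative with respect to the inner product (φ,ψ) ↦ ∫_{B_1} v_* ∇φ·∇ψ dx. -/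
open MeasureTheory Real Filter ENNReal

noncomputable section

/-- The Barenblatt profile `v_*(x) = ((m-1)/(2m)·(1-|x|²))^{1/(m-1)}` (for `m > 1`). -/
def vB (N : ℕ) (m : ℝ) (x : EuclideanSpace ℝ (Fin N)) : ℝ :=
  ((m - 1) / (2 * m) * (1 - ‖x‖ ^ 2)) ^ (1 / (m - 1))

/-- A `C¹` regularisation of `s ↦ (max s 0) ^ p` for `p > 0`. -/
def regPow (p ε s : ℝ) : ℝ := (max s 0) ^ (p + 2) / (max s 0 + ε) ^ 2

/-- The derivative of `regPow p ε`. -/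
def regPowDeriv (p ε s : ℝ) : ℝ :=
  ((p + 2) * (max s 0) ^ (p + 1) * (max s 0 + ε) ^ 2
    - (max s 0) ^ (p + 2) * (2 * (max s 0 + ε))) / ((max s 0 + ε) ^ 2) ^ 2

lemma max_add_pos {ε : ℝ} (hε : 0 < ε) (s : ℝ) : 0 < max s 0 + ε :=
  add_pos_of_nonneg_of_pos (le_max_right _ _) hε

lemma continuous_regPow {p ε : ℝ} (hp : 0 < p) (hε : 0 < ε) : Continuous (regPow p ε) := by
  have h1 : Continuous fun s : ℝ => max s 0 := continuous_id.max continuous_const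
  exact (h1.rpow_const fun s => Or.inr (by linarith)).div ((h1.add continuous_const).pow 2)
    fun s => (pow_pos (max_add_pos hε s) 2).ne'

lemma continuous_regPowDeriv {p ε : ℝ} (hp : 0 < p) (hε : 0 < ε) :
    Continuous (regPowDeriv p ε) := by
  have h1 : Continuous fun s : ℝ => max s 0 := continuous_id.max continuous_const
  have h2 : Continuous fun s : ℝ => (max s 0) ^ (p + 1) :=
    h1.rpow_const fun s => Or.inr (by linarith)
  have h3 : Continuous fun s : ℝ => (max s 0) ^ (p + 2) :=
    h1.rpow_const fun s => Or.inr (by linarith)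
  have h4 : Continuous fun s : ℝ => max s 0 + ε := h1.add continuous_const
  exact (((continuous_const.mul h2).mul (h4.pow 2)).sub (h3.mul (continuous_const.mul h4))).div
    ((h4.pow 2).pow 2) fun s => (pow_pos (pow_pos (max_add_pos hε s) 2) 2).ne'

lemma regPow_of_nonpos {p ε s : ℝ} (hp : 0 < p) (hs : s ≤ 0) : regPow p ε s = 0 := by
  simp [regPow, max_eq_right hs, Real.zero_rpow (by linarith : p + 2 ≠ 0)]

lemma regPowDeriv_of_nonpos {p ε s : ℝ} (hp : 0 < p) (hs : s ≤ 0) : regPowDeriv p ε s = 0 := by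
  simp [regPowDeriv, max_eq_right hs, Real.zero_rpow (by linarith : p + 2 ≠ 0),
    Real.zero_rpow (by linarith : p + 1 ≠ 0)]

lemma hasDerivAt_regPow {p ε : ℝ} (hp : 0 < p) (hε : 0 < ε) (s : ℝ) :
    HasDerivAt (regPow p ε) (regPowDeriv p ε s) s := by
  have key : ∀ y : ℝ, y ≠ 0 → HasDerivAt (regPow p ε) (regPowDeriv p ε y) y := by
    intro y hy
    rcases lt_or_gt_of_ne hy with h | h
    · rw [regPowDeriv_of_nonpos hp h.le]
      refine (hasDerivAt_const y (0 : ℝ)).congr_of_eventuallyEq ?_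
      filter_upwards [gt_mem_nhds h] with z hz using regPow_of_nonpos hp hz.le
    · have h1 : HasDerivAt (fun z : ℝ => z ^ (p + 2)) ((p + 2) * y ^ (p + 1)) y := by
        have := Real.hasDerivAt_rpow_const (x := y) (p := p + 2) (Or.inl hy)
        rwa [show p + 2 - 1 = p + 1 by ring] at this
      have h2 : HasDerivAt (fun z : ℝ => (z + ε) ^ 2) (2 * (y + ε)) y := by
        simpa using ((hasDerivAt_id y).add_const ε).fun_pow 2
      have h3 := h1.div h2 (pow_pos (add_pos h hε) 2).ne'
      have h4 : regPowDeriv p ε y = ((p + 2) * y ^ (p + 1) * (y + ε) ^ 2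
          - y ^ (p + 2) * (2 * (y + ε))) / ((y + ε) ^ 2) ^ 2 := by
        simp [regPowDeriv, max_eq_left h.le]
      rw [h4]
      refine h3.congr_of_eventuallyEq ?_
      filter_upwards [lt_mem_nhds h] with z hz
      simp [regPow, max_eq_left hz.le]
  by_cases hs : s = 0
  · subst hs
    exact hasDerivAt_of_hasDerivAt_of_ne key (continuous_regPow hp hε).continuousAt
      (continuous_regPowDeriv hp hε).continuousAt
  · exact key s hs

lemma regPow_eq {p ε s : ℝ} (hs : 0 < s) :
    regPow p ε s = s ^ (p - 1) * (s ^ 3 / (s + ε) ^ 2) := by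
  have : s ^ (p + 2) = s ^ (p - 1) * s ^ 3 := by
    rw [← Real.rpow_add_natCast hs.ne']; norm_num; ring_nf
  rw [regPow, max_eq_left hs.le, this]; ring

lemma regPowDeriv_eq {p ε s : ℝ} (hs : 0 < s) :
    regPowDeriv p ε s = s ^ (p - 1) *
      (((p + 2) * s ^ 2 * (s + ε) ^ 2 - s ^ 3 * (2 * (s + ε))) / ((s + ε) ^ 2) ^ 2) := by
  have h3 : s ^ (p + 2) = s ^ (p - 1) * s ^ 3 := by
    rw [← Real.rpow_add_natCast hs.ne']; norm_num; ring_nf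
  have h2 : s ^ (p + 1) = s ^ (p - 1) * s ^ 2 := by
    rw [← Real.rpow_add_natCast hs.ne']; norm_num; ring_nf
  rw [regPowDeriv, max_eq_left hs.le, h3, h2]; ring

lemma abs_regPow_le {p ε s : ℝ} (hε : 0 < ε) (hs : 0 < s) (hs1 : s ≤ 1) :
    |regPow p ε s| ≤ s ^ (p - 1) := by
  have h := Real.rpow_nonneg hs.le (p - 1)
  rw [regPow_eq hs, abs_of_nonneg (by positivity)]
  refine mul_le_of_le_one_right h ?_
  rw [div_le_one (by positivity)]
  nlinarith [mul_pos hs hε, sq_nonneg s, sq_nonneg ε]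

lemma abs_regPowDeriv_le {p ε s : ℝ} (hp : 0 < p) (hε : 0 < ε) (hs : 0 < s) :
    |regPowDeriv p ε s| ≤ (p + 4) * s ^ (p - 1) := by
  have h := Real.rpow_nonneg hs.le (p - 1)
  rw [regPowDeriv_eq hs, abs_mul, abs_of_nonneg h, mul_comm]
  refine mul_le_mul_of_nonneg_right ?_ h
  have hd : 0 < ((s + ε) ^ 2) ^ 2 := by positivity
  rw [abs_div, abs_of_pos hd, div_le_iff₀ hd]
  have h2 : s ^ 2 ≤ (s + ε) ^ 2 := by gcongr; linarith
  have h3 : s ^ 3 ≤ (s + ε) ^ 3 := by gcongr; linarith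
  have e1 : (p + 2) * s ^ 2 * (s + ε) ^ 2 ≤ (p + 2) * ((s + ε) ^ 2) ^ 2 := by
    calc (p + 2) * s ^ 2 * (s + ε) ^ 2 ≤ (p + 2) * (s + ε) ^ 2 * (s + ε) ^ 2 := by gcongr
      _ = _ := by ring
  have e2 : s ^ 3 * (2 * (s + ε)) ≤ 2 * ((s + ε) ^ 2) ^ 2 := by
    calc s ^ 3 * (2 * (s + ε)) ≤ (s + ε) ^ 3 * (2 * (s + ε)) := by gcongr
      _ = _ := by ring
  have e3 : 0 ≤ (p + 2) * s ^ 2 * (s + ε) ^ 2 := by positivity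
  have e4 : 0 ≤ s ^ 3 * (2 * (s + ε)) := by positivity
  have e5 : 0 ≤ (p + 2) * ((s + ε) ^ 2) ^ 2 := by positivity
  rw [abs_le]
  constructor <;> linarith

lemma tendsto_regPow {p s : ℝ} (hs : 0 < s) :
    Tendsto (fun n : ℕ => regPow p (1 / ((n : ℝ) + 1)) s) atTop (nhds (s ^ p)) := by
  have hc : ContinuousAt (fun ε : ℝ => s ^ (p - 1) * (s ^ 3 / (s + ε) ^ 2)) 0 := by
    refine continuousAt_const.mul (continuousAt_const.div (by fun_prop) (by simpa using hs.ne'))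
  have h := hc.tendsto.comp (tendsto_one_div_add_atTop_nhds_zero_nat (𝕜 := ℝ))
  have e : s ^ (p - 1) * (s ^ 3 / (s + 0) ^ 2) = s ^ p := by
    rw [Real.rpow_sub_one hs.ne']; field_simp; simp
  rw [e] at h
  exact h.congr fun n => (regPow_eq hs).symm

lemma tendsto_regPowDeriv {p s : ℝ} (hs : 0 < s) :
    Tendsto (fun n : ℕ => regPowDeriv p (1 / ((n : ℝ) + 1)) s) atTop
      (nhds (p * s ^ (p - 1))) := by
  have hc : ContinuousAt (fun ε : ℝ => s ^ (p - 1) *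
      (((p + 2) * s ^ 2 * (s + ε) ^ 2 - s ^ 3 * (2 * (s + ε))) / ((s + ε) ^ 2) ^ 2)) 0 := by
    refine continuousAt_const.mul (ContinuousAt.div (by fun_prop) (by fun_prop)
      (by simpa using hs.ne'))
  have h := hc.tendsto.comp (tendsto_one_div_add_atTop_nhds_zero_nat (𝕜 := ℝ))
  have e : s ^ (p - 1) * (((p + 2) * s ^ 2 * (s + 0) ^ 2 - s ^ 3 * (2 * (s + 0))) /
      ((s + 0) ^ 2) ^ 2) = p * s ^ (p - 1) := by
    field_simp; ring
  rw [e] at h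
  exact h.congr fun n => (regPowDeriv_eq hs).symm

lemma integrableOn_ball_one_sub_norm_sq_rpow {E : Type*} [NormedAddCommGroup E]
    [NormedSpace ℝ E] [FiniteDimensional ℝ E] [MeasurableSpace E] [BorelSpace E]
    [Nontrivial E] (μ : Measure E) [μ.IsAddHaarMeasure] {q : ℝ} (hq : -1 < q) :
    IntegrableOn (fun x : E => (1 - ‖x‖ ^ 2) ^ q) (Metric.ball 0 1) μ := by
  have h1 : IntervalIntegrable (fun r : ℝ => (1 - r) ^ q) volume 0 1 := by
    simpa using ((intervalIntegral.intervalIntegrable_rpow' hq (a := 0) (b := 1)).comp_sub_left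
      1).symm
  have hc : ContinuousOn (fun r : ℝ => r ^ (Module.finrank ℝ E - 1) * (1 + r) ^ q)
      (Set.uIcc 0 1) := by
    rw [Set.uIcc_of_le zero_le_one]
    refine (continuousOn_pow _).mul ((continuousOn_const.add continuousOn_id).rpow_const ?_)
    intro r hr
    exact Or.inl (by simpa using (by linarith [hr.1] : (0 : ℝ) < 1 + r).ne')
  have h2 := h1.continuousOn_mul hc
  rw [intervalIntegrable_iff_integrableOn_Ioo_of_le zero_le_one] at h2
  refine (integrableOn_fun_norm_addHaar μ (f := fun r : ℝ => (1 - r ^ 2) ^ q)).2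
    (h2.congr_fun ?_ measurableSet_Ioo)
  intro r hr
  have e : 1 - r ^ 2 = (1 + r) * (1 - r) := by ring
  simp only [smul_eq_mul]
  rw [e, Real.mul_rpow (by linarith [hr.1]) (by linarith [hr.2]), mul_assoc]

lemma contDiff_pdv {N : ℕ} {f : EuclideanSpace ℝ (Fin N) → ℝ} (hf : ContDiff ℝ (⊤ : ℕ∞) f)
    (i : Fin N) : ContDiff ℝ (⊤ : ℕ∞) (pdv N f i) :=
  (hf.fderiv_right (m := (⊤ : ℕ∞)) (by simp)).clm_apply contDiff_const

lemma contDiff_lap {N : ℕ} {f : EuclideanSpace ℝ (Fin N) → ℝ} (hf : ContDiff ℝ (⊤ : ℕ∞) f) :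
    ContDiff ℝ (⊤ : ℕ∞) (lap N f) :=
  ContDiff.sum fun i _ => contDiff_pdv (contDiff_pdv hf i) i

lemma contDiff_coord {N : ℕ} (i : Fin N) :
    ContDiff ℝ (⊤ : ℕ∞) fun x : EuclideanSpace ℝ (Fin N) => x i := by
  fun_prop

lemma contDiff_HE {N : ℕ} {m : ℝ} {f : EuclideanSpace ℝ (Fin N) → ℝ}
    (hf : ContDiff ℝ (⊤ : ℕ∞) f) : ContDiff ℝ (⊤ : ℕ∞) (HE N m f) :=
  ((contDiff_const.mul (contDiff_const.sub (contDiff_norm_sq ℝ))).mul (contDiff_lap hf)).add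
    (ContDiff.sum fun i _ => (contDiff_coord i).mul (contDiff_pdv hf i))

lemma pdv_mul {N : ℕ} {f g : EuclideanSpace ℝ (Fin N) → ℝ} (hf : ContDiff ℝ (⊤ : ℕ∞) f)
    (hg : ContDiff ℝ (⊤ : ℕ∞) g) (i : Fin N) (x : EuclideanSpace ℝ (Fin N)) :
    pdv N (fun y => f y * g y) i x = f x * pdv N g i x + g x * pdv N f i x := by
  have h := fderiv_fun_mul ((hf.differentiable (by simp)) x) ((hg.differentiable (by simp)) x)
  simp [pdv, h]

lemma eqOn_pdv {N : ℕ} {f g : EuclideanSpace ℝ (Fin N) → ℝ}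
    {s : Set (EuclideanSpace ℝ (Fin N))} (hs : IsOpen s) (h : Set.EqOn f g s) (i : Fin N) :
    Set.EqOn (pdv N f i) (pdv N g i) s := fun x hx => by
  have := (h.eventuallyEq_of_mem (hs.mem_nhds hx)).fderiv_eq (𝕜 := ℝ)
  simp [pdv, this]

lemma eqOn_HE {N : ℕ} {m : ℝ} {f g : EuclideanSpace ℝ (Fin N) → ℝ}
    {s : Set (EuclideanSpace ℝ (Fin N))} (hs : IsOpen s) (h : Set.EqOn f g s) :
    Set.EqOn (HE N m f) (HE N m g) s := fun x hx => by
  have h1 : ∀ i, pdv N f i x = pdv N g i x := fun i => eqOn_pdv hs h i hx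
  have h2 : ∀ i, pdv N (pdv N f i) i x = pdv N (pdv N g i) i x :=
    fun i => eqOn_pdv hs (eqOn_pdv hs h i) i hx
  simp [HE, lap, h1, h2]

/-- A function smooth near the closed unit ball agrees on it with a globally smooth function. -/
lemma exists_contDiff_eqOn_ball {E : Type*} [NormedAddCommGroup E] [InnerProductSpace ℝ E]
    [FiniteDimensional ℝ E] {f : E → ℝ} {U : Set E} (hU : IsOpen U)
    (hUball : Metric.closedBall 0 1 ⊆ U) (hf : ContDiffOn ℝ (⊤ : ℕ∞) f U) :
    ∃ g : E → ℝ, ContDiff ℝ (⊤ : ℕ∞) g ∧ Set.EqOn f g (Metric.ball 0 1) := by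
  obtain ⟨δ, hδ, hδU⟩ := (isCompact_closedBall (0 : E) 1).exists_cthickening_subset_open hU hUball
  rw [cthickening_closedBall hδ.le zero_le_one] at hδU
  let χ : ContDiffBump (0 : E) := ⟨1, 1 + δ, one_pos, by linarith⟩
  refine ⟨fun x => χ x * f x, ?_, ?_⟩
  · refine contDiff_iff_contDiffAt.2 fun x => ?_
    by_cases hx : x ∈ tsupport fun x => χ x * f x
    swap
    · exact contDiffAt_const.congr_of_eventuallyEq (notMem_tsupport_iff_eventuallyEq.1 hx)
    have hx2 : x ∈ U := by
      have h1 := tsupport_mul_subset_left (f := (χ : E → ℝ)) (g := f) hx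
      rw [χ.tsupport_eq] at h1
      exact hδU (by simpa [χ, add_comm] using h1)
    exact χ.contDiffAt.mul (hf.contDiffAt (hU.mem_nhds hx2))
  · intro x hx
    have : χ x = 1 := χ.one_of_mem_closedBall (Metric.ball_subset_closedBall hx)
    simp [this]

lemma hasFDerivAt_regPow_one_sub_norm_sq {E : Type*} [NormedAddCommGroup E]
    [InnerProductSpace ℝ E] {p ε : ℝ} (hp : 0 < p) (hε : 0 < ε) (x : E) :
    HasFDerivAt (fun y : E => regPow p ε (1 - ‖y‖ ^ 2))
      (regPowDeriv p ε (1 - ‖x‖ ^ 2) • -((2 : ℕ) • (innerSL ℝ x : E →L[ℝ] ℝ))) x := by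
  have h := (hasStrictFDerivAt_norm_sq x).hasFDerivAt.const_sub 1
  exact (hasDerivAt_regPow hp hε _).comp_hasFDerivAt x h

lemma hasCompactSupport_of_one_sub_norm_sq {E : Type*} [NormedAddCommGroup E]
    [InnerProductSpace ℝ E] [FiniteDimensional ℝ E] {θ : ℝ → ℝ} (hθ : ∀ s ≤ 0, θ s = 0) :
    HasCompactSupport fun y : E => θ (1 - ‖y‖ ^ 2) := by
  refine HasCompactSupport.intro (isCompact_closedBall (0 : E) 1) fun x hx => hθ _ ?_
  have : 1 < ‖x‖ := by simpa using hx
  nlinarith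

lemma integral_regPow_mul_pdv {N : ℕ} {p ε : ℝ} (hp : 0 < p) (hε : 0 < ε)
    {k : EuclideanSpace ℝ (Fin N) → ℝ} (hk : ContDiff ℝ (⊤ : ℕ∞) k) (i : Fin N) :
    Integrable (fun x => regPow p ε (1 - ‖x‖ ^ 2) * pdv N k i x) ∧
    Integrable (fun x => regPowDeriv p ε (1 - ‖x‖ ^ 2) * (2 * (x i * k x))) ∧
    ∫ x, regPow p ε (1 - ‖x‖ ^ 2) * pdv N k i x
      = ∫ x, regPowDeriv p ε (1 - ‖x‖ ^ 2) * (2 * (x i * k x)) := by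
  have hw : Continuous fun x : EuclideanSpace ℝ (Fin N) => 1 - ‖x‖ ^ 2 := by fun_prop
  have c1 := (continuous_regPow hp hε).comp hw
  have c2 := (continuous_regPowDeriv hp hε).comp hw
  have s1 : HasCompactSupport fun y : EuclideanSpace ℝ (Fin N) => regPow p ε (1 - ‖y‖ ^ 2) :=
    hasCompactSupport_of_one_sub_norm_sq fun s hs => regPow_of_nonpos hp hs
  have s2 : HasCompactSupport fun y : EuclideanSpace ℝ (Fin N) =>
      regPowDeriv p ε (1 - ‖y‖ ^ 2) :=
    hasCompactSupport_of_one_sub_norm_sq fun s hs => regPowDeriv_of_nonpos hp hs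
  have i1 : Integrable fun x => regPow p ε (1 - ‖x‖ ^ 2) * pdv N k i x :=
    (c1.mul (contDiff_pdv hk i).continuous).integrable_of_hasCompactSupport s1.mul_right
  have i2 : Integrable fun x : EuclideanSpace ℝ (Fin N) =>
      regPowDeriv p ε (1 - ‖x‖ ^ 2) * (2 * (x i * k x)) :=
    (c2.mul (continuous_const.mul ((contDiff_coord i).continuous.mul
      hk.continuous))).integrable_of_hasCompactSupport s2.mul_right
  have i3 : Integrable fun x => regPow p ε (1 - ‖x‖ ^ 2) * k x :=
    (c1.mul hk.continuous).integrable_of_hasCompactSupport s1.mul_right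
  have e : ∀ x : EuclideanSpace ℝ (Fin N),
      fderiv ℝ (fun y : EuclideanSpace ℝ (Fin N) => regPow p ε (1 - ‖y‖ ^ 2)) x
        (EuclideanSpace.single i 1) * k x
      = -(regPowDeriv p ε (1 - ‖x‖ ^ 2) * (2 * (x i * k x))) := fun x => by
    rw [(hasFDerivAt_regPow_one_sub_norm_sq hp hε x).fderiv]
    simp [EuclideanSpace.inner_single_right]
    ring
  refine ⟨i1, i2, ?_⟩
  have h := integral_mul_fderiv_eq_neg_fderiv_mul_of_integrable (μ := volume)
    (v := EuclideanSpace.single i (1 : ℝ))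
    (f := fun y : EuclideanSpace ℝ (Fin N) => regPow p ε (1 - ‖y‖ ^ 2)) (g := k)
    (by simp only [e]; exact i2.neg) i1 i3
    (fun x _ => (hasFDerivAt_regPow_one_sub_norm_sq hp hε x).differentiableAt)
    (fun x _ => hk.differentiable (by simp) x)
  simp only [e, integral_neg, neg_neg] at h
  exact h

lemma one_sub_norm_sq_mem_Ioc {E : Type*} [NormedAddCommGroup E] {x : E}
    (hx : x ∈ Metric.ball (0 : E) 1) : 0 < 1 - ‖x‖ ^ 2 ∧ 1 - ‖x‖ ^ 2 ≤ 1 := by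
  have h : ‖x‖ < 1 := by simpa using hx
  constructor <;> nlinarith [norm_nonneg x]

lemma integrableOn_ball_rpow_mul {N : ℕ} (hN : 1 ≤ N) {q : ℝ} (hq : -1 < q)
    {a : EuclideanSpace ℝ (Fin N) → ℝ} (ha : Continuous a) :
    IntegrableOn (fun x => (1 - ‖x‖ ^ 2) ^ q * a x) (Metric.ball 0 1) := by
  have : Nonempty (Fin N) := ⟨⟨0, hN⟩⟩
  obtain ⟨C, hC⟩ :=
    (isCompact_closedBall (0 : EuclideanSpace ℝ (Fin N)) 1).exists_bound_of_continuousOn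
    ha.continuousOn
  refine Integrable.mul_bdd (c := C) (integrableOn_ball_one_sub_norm_sq_rpow volume hq)
    ha.aestronglyMeasurable ?_
  filter_upwards [ae_restrict_mem measurableSet_ball] with x hx
  exact hC x (Metric.ball_subset_closedBall hx)

/-- The divergence theorem for the field `(1 - ‖x‖ ^ 2) ^ p • k` on the unit ball. -/
lemma integral_ball_divergence_rpow {N : ℕ} (hN : 1 ≤ N) {p : ℝ} (hp : 0 < p)
    {k : Fin N → EuclideanSpace ℝ (Fin N) → ℝ} (hk : ∀ i, ContDiff ℝ (⊤ : ℕ∞) (k i)) :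
    ∫ x in Metric.ball (0 : EuclideanSpace ℝ (Fin N)) 1,
      ((1 - ‖x‖ ^ 2) ^ p * ∑ i, pdv N (k i) i x
        - p * (1 - ‖x‖ ^ 2) ^ (p - 1) * ∑ i, 2 * (x i * k i x)) = 0 := by
  have : Nonempty (Fin N) := ⟨⟨0, hN⟩⟩
  have ha : Continuous fun x => ∑ i, pdv N (k i) i x :=
    continuous_finsetSum _ fun i _ => (contDiff_pdv (hk i) i).continuous
  have hb : Continuous fun x : EuclideanSpace ℝ (Fin N) => ∑ i, 2 * (x i * k i x) :=
    continuous_finsetSum _ fun i _ =>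
      continuous_const.mul ((contDiff_coord i).continuous.mul (hk i).continuous)
  have hε : ∀ n : ℕ, 0 < 1 / ((n : ℝ) + 1) := fun n => Nat.one_div_pos_of_nat
  have hw : Continuous fun x : EuclideanSpace ℝ (Fin N) => 1 - ‖x‖ ^ 2 := by fun_prop
  set F : ℕ → EuclideanSpace ℝ (Fin N) → ℝ := fun n x =>
    regPow p (1 / ((n : ℝ) + 1)) (1 - ‖x‖ ^ 2) * ∑ i, pdv N (k i) i x
      - regPowDeriv p (1 / ((n : ℝ) + 1)) (1 - ‖x‖ ^ 2) * ∑ i, 2 * (x i * k i x) with hF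
  have hzero : ∀ n, ∫ x in Metric.ball (0 : EuclideanSpace ℝ (Fin N)) 1, F n x = 0 := by
    intro n
    rw [setIntegral_eq_integral_of_forall_compl_eq_zero]
    · have h := fun i => integral_regPow_mul_pdv hp (hε n) (hk i) i
      simp only [hF, Finset.mul_sum]
      rw [integral_sub (integrable_finsetSum _ fun i _ => (h i).1)
        (integrable_finsetSum _ fun i _ => (h i).2.1),
        integral_finsetSum _ fun i _ => (h i).1, integral_finsetSum _ fun i _ => (h i).2.1]
      simp only [(h _).2.2, sub_self]
    · intro x hx
      have h1 : 1 ≤ ‖x‖ := by simpa using hx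
      have h2 : 1 - ‖x‖ ^ 2 ≤ 0 := by nlinarith
      simp only [hF, regPow_of_nonpos hp h2, regPowDeriv_of_nonpos hp h2, zero_mul, sub_zero]
  obtain ⟨A, hA⟩ :=
    (isCompact_closedBall (0 : EuclideanSpace ℝ (Fin N)) 1).exists_bound_of_continuousOn
    ha.continuousOn
  obtain ⟨B, hB⟩ :=
    (isCompact_closedBall (0 : EuclideanSpace ℝ (Fin N)) 1).exists_bound_of_continuousOn
    hb.continuousOn
  have hlim := tendsto_integral_of_dominated_convergence
    (μ := volume.restrict (Metric.ball (0 : EuclideanSpace ℝ (Fin N)) 1)) (F := F)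
    (f := fun x => (1 - ‖x‖ ^ 2) ^ p * ∑ i, pdv N (k i) i x
        - p * (1 - ‖x‖ ^ 2) ^ (p - 1) * ∑ i, 2 * (x i * k i x))
    (fun x => (1 - ‖x‖ ^ 2) ^ (p - 1) * (A + (p + 4) * B))
    (fun n => ((((continuous_regPow hp (hε n)).comp hw).mul ha).sub
      (((continuous_regPowDeriv hp (hε n)).comp hw).mul hb)).aestronglyMeasurable)
    (integrableOn_ball_rpow_mul hN (by linarith) continuous_const)
    (fun n => by
      filter_upwards [ae_restrict_mem measurableSet_ball] with x hx
      obtain ⟨h0, h1⟩ := one_sub_norm_sq_mem_Ioc hx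
      have hA' := hA x (Metric.ball_subset_closedBall hx)
      have hB' := hB x (Metric.ball_subset_closedBall hx)
      have r1 := abs_regPow_le (p := p) (hε n) h0 h1
      have r2 := abs_regPowDeriv_le hp (hε n) h0
      refine (norm_sub_le _ _).trans ?_
      rw [norm_mul, norm_mul]
      calc _ ≤ (1 - ‖x‖ ^ 2) ^ (p - 1) * A + (p + 4) * (1 - ‖x‖ ^ 2) ^ (p - 1) * B := by
            refine add_le_add (mul_le_mul r1 hA' (norm_nonneg _) ?_)
              (mul_le_mul r2 hB' (norm_nonneg _) ?_)
            · positivity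
            · positivity
        _ = _ := by ring)
    (by
      filter_upwards [ae_restrict_mem measurableSet_ball] with x hx
      obtain ⟨h0, h1⟩ := one_sub_norm_sq_mem_Ioc hx
      exact ((tendsto_regPow h0).mul_const _).sub ((tendsto_regPowDeriv h0).mul_const _))
  simp only [hzero] at hlim
  exact (tendsto_nhds_unique hlim tendsto_const_nhds)

/-- Integration by parts: `∫ v_* ∇f·∇g = c ∫ (1 - |x|²) ^ (1/(m-1) - 1) (H_E f) g`
for an explicit constant `c`. -/
lemma integral_vB_mul_grad {N : ℕ} (hN : 1 ≤ N) {m : ℝ} (hm : 1 < m)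
    {f g : EuclideanSpace ℝ (Fin N) → ℝ} (hf : ContDiff ℝ (⊤ : ℕ∞) f)
    (hg : ContDiff ℝ (⊤ : ℕ∞) g) :
    ∫ x in Metric.ball (0 : EuclideanSpace ℝ (Fin N)) 1,
      vB N m x * ∑ i, pdv N f i x * pdv N g i x
    = ((m - 1) / (2 * m)) ^ (1 / (m - 1)) * (2 / (m - 1)) *
      ∫ x in Metric.ball (0 : EuclideanSpace ℝ (Fin N)) 1,
        (1 - ‖x‖ ^ 2) ^ (1 / (m - 1) - 1) * (HE N m f x * g x) := by
  have hm1 : 0 < m - 1 := by linarith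
  set p := 1 / (m - 1) with hpdef
  have hp : 0 < p := by positivity
  have hdiv := integral_ball_divergence_rpow hN hp
    (k := fun i x => g x * pdv N f i x) fun i => hg.mul (contDiff_pdv hf i)
  have hcont : Continuous fun x => ∑ i, pdv N f i x * pdv N g i x :=
    continuous_finsetSum _ fun i _ =>
      (contDiff_pdv hf i).continuous.mul (contDiff_pdv hg i).continuous
  have i1 := integrableOn_ball_rpow_mul hN (q := p) (by linarith) hcont
  have i2 := (integrableOn_ball_rpow_mul hN (q := p - 1) (by linarith)
    ((contDiff_HE (m := m) hf).continuous.fun_mul hg.continuous)).const_mul (2 / (m - 1))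
  have hcongr : ∫ x in Metric.ball (0 : EuclideanSpace ℝ (Fin N)) 1,
      ((1 - ‖x‖ ^ 2) ^ p * ∑ i, pdv N (fun y => g y * pdv N f i y) i x
        - p * (1 - ‖x‖ ^ 2) ^ (p - 1) * ∑ i, 2 * (x i * (g x * pdv N f i x)))
      = ∫ x in Metric.ball (0 : EuclideanSpace ℝ (Fin N)) 1,
        ((1 - ‖x‖ ^ 2) ^ p * ∑ i, pdv N f i x * pdv N g i x
          - 2 / (m - 1) * ((1 - ‖x‖ ^ 2) ^ (p - 1) * (HE N m f x * g x))) := by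
    refine setIntegral_congr_fun measurableSet_ball fun x hx => ?_
    obtain ⟨h0, -⟩ := one_sub_norm_sq_mem_Ioc hx
    have e1 : ∑ i, pdv N (fun y => g y * pdv N f i y) i x
        = g x * lap N f x + ∑ i, pdv N f i x * pdv N g i x := by
      simp only [pdv_mul hg (contDiff_pdv hf _), Finset.sum_add_distrib, lap, Finset.mul_sum]
    have e2 : ∑ i, 2 * (x i * (g x * pdv N f i x)) = 2 * g x * ∑ i, x i * pdv N f i x := by
      rw [Finset.mul_sum]
      exact Finset.sum_congr rfl fun i _ => by ring
    have e3 : (1 - ‖x‖ ^ 2) ^ p = (1 - ‖x‖ ^ 2) ^ (p - 1) * (1 - ‖x‖ ^ 2) := by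
      rw [Real.rpow_sub_one h0.ne']; field_simp
    simp only [e1, e2, HE]
    rw [e3]
    have e4 : p * (m - 1) = 1 := by rw [hpdef]; field_simp
    have e5 : 2 / (m - 1) = 2 * p := by rw [hpdef]; ring
    rw [e5]
    linear_combination (-(1 - ‖x‖ ^ 2) ^ (p - 1) * (1 - ‖x‖ ^ 2) * lap N f x * g x) * e4
  rw [hcongr, integral_sub i1 i2, integral_const_mul] at hdiv
  have hv : ∀ x ∈ Metric.ball (0 : EuclideanSpace ℝ (Fin N)) 1,
      vB N m x * ∑ i, pdv N f i x * pdv N g i x = ((m - 1) / (2 * m)) ^ p *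
        ((1 - ‖x‖ ^ 2) ^ p * ∑ i, pdv N f i x * pdv N g i x) := by
    intro x hx
    rw [vB, Real.mul_rpow (by positivity) (one_sub_norm_sq_mem_Ioc hx).1.le, mul_assoc]
  rw [setIntegral_congr_fun measurableSet_ball hv, integral_const_mul, mul_assoc,
    sub_eq_zero.1 hdiv]

lemma integral_vB_mul_grad_HE_HE {N : ℕ} (hN : 1 ≤ N) {m : ℝ} (hm : 1 < m)
    {ψ φ : EuclideanSpace ℝ (Fin N) → ℝ} {U : Set (EuclideanSpace ℝ (Fin N))} (hU : IsOpen U)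
    (hUball : Metric.closedBall 0 1 ⊆ U)
    (hψ : ContDiffOn ℝ (⊤ : ℕ∞) ψ U) (hφ : ContDiffOn ℝ (⊤ : ℕ∞) φ U) :
    ∫ x in Metric.ball (0 : EuclideanSpace ℝ (Fin N)) 1,
        vB N m x * ∑ i, pdv N φ i x * pdv N (HE N m (HE N m ψ)) i x
      = ∫ x in Metric.ball (0 : EuclideanSpace ℝ (Fin N)) 1,
          vB N m x * ∑ i, pdv N (HE N m φ) i x * pdv N (HE N m ψ) i x := by
  obtain ⟨ψ', hψ', eψ⟩ := exists_contDiff_eqOn_ball hU hUball hψ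
  obtain ⟨φ', hφ', eφ⟩ := exists_contDiff_eqOn_ball hU hUball hφ
  have ob : IsOpen (Metric.ball (0 : EuclideanSpace ℝ (Fin N)) 1) := Metric.isOpen_ball
  have l : ∫ x in Metric.ball (0 : EuclideanSpace ℝ (Fin N)) 1,
        vB N m x * ∑ i, pdv N φ i x * pdv N (HE N m (HE N m ψ)) i x
      = ∫ x in Metric.ball (0 : EuclideanSpace ℝ (Fin N)) 1,
        vB N m x * ∑ i, pdv N φ' i x * pdv N (HE N m (HE N m ψ')) i x := by
    refine setIntegral_congr_fun measurableSet_ball fun x hx => ?_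
    simp only [eqOn_pdv ob eφ _ hx, eqOn_pdv ob (eqOn_HE ob (eqOn_HE ob eψ)) _ hx]
  have r : ∫ x in Metric.ball (0 : EuclideanSpace ℝ (Fin N)) 1,
        vB N m x * ∑ i, pdv N (HE N m φ) i x * pdv N (HE N m ψ) i x
      = ∫ x in Metric.ball (0 : EuclideanSpace ℝ (Fin N)) 1,
        vB N m x * ∑ i, pdv N (HE N m ψ') i x * pdv N (HE N m φ') i x := by
    refine setIntegral_congr_fun measurableSet_ball fun x hx => ?_
    simp only [eqOn_pdv ob (eqOn_HE ob eφ) _ hx, eqOn_pdv ob (eqOn_HE ob eψ) _ hx,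
      mul_comm (pdv N (HE N m φ') _ x)]
  rw [l, r, integral_vB_mul_grad hN hm hφ' (contDiff_HE (contDiff_HE hψ')),
    integral_vB_mul_grad hN hm (contDiff_HE hψ') (contDiff_HE hφ')]
  simp only [mul_comm (HE N m φ' _)]

/-- For `m > 1` and `ψ, φ` smooth on a neighborhood of the closed unit ball,
`∫_{B_1} v_* ∇φ·∇(H_E² ψ) dx = ∫_{B_1} v_* ∇(H_E φ)·∇(H_E ψ) dx`; in particular (`φ = ψ`)
`H_E²` is symmetric and nonnegative for the inner product `(φ,ψ) ↦ ∫_{B_1} v_* ∇φ·∇ψ dx`. -/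
theorem stmt5 (N : ℕ) (hN : 1 ≤ N) (m : ℝ) (hm : 1 < m)
    (ψ φ : EuclideanSpace ℝ (Fin N) → ℝ)
    (U : Set (EuclideanSpace ℝ (Fin N))) (hU : IsOpen U)
    (hUball : Metric.closedBall 0 1 ⊆ U)
    (hψ : ContDiffOn ℝ (⊤ : ℕ∞) ψ U) (hφ : ContDiffOn ℝ (⊤ : ℕ∞) φ U) :
    (∫ x in Metric.ball (0 : EuclideanSpace ℝ (Fin N)) 1,
        vB N m x * ∑ i, pdv N φ i x * pdv N (HE N m (HE N m ψ)) i x)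
      = (∫ x in Metric.ball (0 : EuclideanSpace ℝ (Fin N)) 1,
          vB N m x * ∑ i, pdv N (HE N m φ) i x * pdv N (HE N m ψ) i x) ∧
    0 ≤ ∫ x in Metric.ball (0 : EuclideanSpace ℝ (Fin N)) 1,
          vB N m x * ∑ i, pdv N ψ i x * pdv N (HE N m (HE N m ψ)) i x := by
  refine ⟨integral_vB_mul_grad_HE_HE hN hm hU hUball hψ hφ, ?_⟩
  rw [integral_vB_mul_grad_HE_HE hN hm hU hUball hψ hψ]
  refine setIntegral_nonneg measurableSet_ball fun x hx => ?_
  refine mul_nonneg (Real.rpow_nonneg (mul_nonneg ?_ (one_sub_norm_sq_mem_Ioc hx).1.le) _)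
    (Finset.sum_nonneg fun i _ => mul_self_nonneg _)
  exact div_nonneg (by linarith) (by linarith)
end
end

section
/- Let N ≥ 1 and let ψ : ℝ^N → ℝ be a locally integrable function with weak gradient satisfying ∫_{ℝ^N} e^{-|x|²/2} |∇ψ(x)|² dx < ∞. Then for every ε > 0 there exists a smooth bounded function φ : ℝ^N → ℝ such that ∫_{ℝ^N} e^{-|x|²/2} |∇ψ(x) - ∇φ(x)|² dx < ε. That is, bounded smooth functions are dense in the weighted homogeneous Sobolev space with Gaussian weight. -/
open MeasureTheory Real Filter ENNReal

noncomputable section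

/-- `g` is the weak gradient of `ψ` on `ℝ^N`: both are locally integrable and for every
smooth compactly supported test function `φ`, `∫ ψ ∂_i φ = -∫ g_i φ` for all `i`. -/
def HasWeakGradient (N : ℕ) (ψ : EuclideanSpace ℝ (Fin N) → ℝ)
    (g : EuclideanSpace ℝ (Fin N) → EuclideanSpace ℝ (Fin N)) : Prop :=
  MeasureTheory.LocallyIntegrable ψ volume ∧ MeasureTheory.LocallyIntegrable g volume ∧
  ∀ (i : Fin N) (φ : EuclideanSpace ℝ (Fin N) → ℝ), ContDiff ℝ (⊤ : ℕ∞) φ → HasCompactSupport φ →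
    ∫ x, ψ x * fderiv ℝ φ x (EuclideanSpace.single i 1) = -∫ x, g x i * φ x

/-- Dominated convergence to zero with dominating functions that converge in `L¹`. -/
theorem tendsto_integral_zero_of_le_tendsto {α : Type*} [MeasurableSpace α] {μ : Measure α}
    {f F : ℕ → α → ℝ} {H : α → ℝ}
    (hf : ∀ n, AEStronglyMeasurable (f n) μ) (hf0 : ∀ n x, 0 ≤ f n x)
    (hfF : ∀ n x, f n x ≤ F n x) (hF : ∀ n, Integrable (F n) μ) (hH : Integrable H μ)
    (hf_lim : ∀ᵐ x ∂μ, Tendsto (fun n => f n x) atTop (nhds 0))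
    (hF_lim : ∀ᵐ x ∂μ, Tendsto (fun n => F n x) atTop (nhds (H x)))
    (hint : Tendsto (fun n => ∫ x, F n x ∂μ) atTop (nhds (∫ x, H x ∂μ))) :
    Tendsto (fun n => ∫ x, f n x ∂μ) atTop (nhds 0) := by
  have hH0 : ∀ᵐ x ∂μ, 0 ≤ H x := by
    filter_upwards [hF_lim] with x hx
    exact ge_of_tendsto' hx fun n => (hf0 n x).trans (hfF n x)
  have hfi : ∀ n, Integrable (f n) μ := fun n =>
    (hF n).mono' (hf n) (.of_forall fun x => by
      rw [Real.norm_of_nonneg (hf0 n x)]; exact hfF n x)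
  have hmin : Tendsto (fun n => ∫ x, min (f n x) (H x) ∂μ) atTop (nhds (∫ _, (0 : ℝ) ∂μ)) := by
    refine tendsto_integral_of_dominated_convergence H
      (fun n => ((hfi n).inf hH).aestronglyMeasurable) hH (fun n => ?_) ?_
    · filter_upwards [hH0] with x hx
      rw [Real.norm_of_nonneg (le_min (hf0 n x) hx)]
      exact min_le_right _ _
    · filter_upwards [hf_lim, hH0] with x hx h0
      simpa [h0] using hx.min (tendsto_const_nhds (x := H x))
  have hpos : Tendsto (fun n => ∫ x, max (H x - F n x) 0 ∂μ) atTop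
      (nhds (∫ _, (0 : ℝ) ∂μ)) := by
    refine tendsto_integral_of_dominated_convergence H
      (fun n => (hH.sub (hF n)).pos_part.aestronglyMeasurable) hH (fun n => ?_) ?_
    · filter_upwards [hH0] with x hx
      rw [Real.norm_of_nonneg (le_max_right _ _)]
      exact max_le (by linarith [(hf0 n x).trans (hfF n x)]) hx
    · filter_upwards [hF_lim] with x hx
      simpa using (hx.const_sub (H x)).max (tendsto_const_nhds (x := (0 : ℝ)))
  have hupper : Tendsto (fun n => (∫ x, min (f n x) (H x) ∂μ) +
      ((∫ x, F n x ∂μ) - ∫ x, H x ∂μ) + 2 * ∫ x, max (H x - F n x) 0 ∂μ) atTop (nhds 0) := by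
    simpa using (hmin.add (hint.sub_const (∫ x, H x ∂μ))).add (hpos.const_mul 2)
  refine squeeze_zero (fun n => integral_nonneg (hf0 n)) (fun n => ?_) hupper
  have h1 : Integrable (fun x => min (f n x) (H x)) μ := (hfi n).inf hH
  have h2 : Integrable (fun x => F n x - H x) μ := (hF n).sub hH
  have h3 : Integrable (fun x => max (H x - F n x) 0) μ := (hH.sub (hF n)).pos_part
  rw [← integral_sub (hF n) hH, ← integral_const_mul, ← integral_add h1 h2,
    ← integral_add (by exact h1.add h2) (h3.const_mul 2)]
  refine integral_mono (hfi n) ((h1.add h2).add (h3.const_mul 2)) fun x => ?_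
  have hx := hfF n x
  simp only
  rcases le_total (f n x) (H x) with h | h <;>
    rcases le_total (H x - F n x) 0 with h' | h' <;> simp [h, h'] <;> linarith

section Mollification

variable {E F : Type*} [NormedAddCommGroup E] [InnerProductSpace ℝ E] [FiniteDimensional ℝ E]
  [MeasurableSpace E] [BorelSpace E] [NormedAddCommGroup F] [NormedSpace ℝ F]

theorem ContDiffBump.norm_convolution_sq_le (φ : ContDiffBump (0 : E)) {G : E → F}
    (hG : MemLp G 2 (volume : Measure E)) (x : E) :
    ‖convolution (φ.normed volume) G (ContinuousLinearMap.lsmul ℝ ℝ) volume x‖ ^ 2 ≤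
      convolution (φ.normed volume) (fun y => ‖G y‖ ^ 2)
        (ContinuousLinearMap.lsmul ℝ ℝ) volume x := by
  set η := φ.normed (volume : Measure E) with hη
  have hη0 : ∀ t, 0 ≤ η t := φ.nonneg_normed
  have hsq : Integrable (fun y => ‖G y‖ ^ 2) (volume : Measure E) :=
    (memLp_two_iff_integrable_sq_norm hG.1).1 hG
  have hηc : Continuous η := φ.continuous_normed
  have hηs : HasCompactSupport η := φ.hasCompactSupport_normed
  have i1 : Integrable (fun t => η t * ‖G (x - t)‖) (volume : Measure E) :=
    hηs.convolutionExists_left (ContinuousLinearMap.lsmul ℝ ℝ) hηc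
      (hG.norm.locallyIntegrable (by norm_num)) x
  have i2 : Integrable (fun t => η t * ‖G (x - t)‖ ^ 2) (volume : Measure E) :=
    hηs.convolutionExists_left (ContinuousLinearMap.lsmul ℝ ℝ) hηc hsq.locallyIntegrable x
  have i0 : Integrable η (volume : Measure E) := φ.integrable_normed
  set m := ∫ t, η t * ‖G (x - t)‖ with hm
  have h1 : ‖convolution η G (ContinuousLinearMap.lsmul ℝ ℝ) volume x‖ ≤ m := by
    rw [convolution_def]
    refine (norm_integral_le_integral_norm _).trans (le_of_eq ?_)
    simp [norm_smul, abs_of_nonneg (hη0 _), hm]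
  have h2 : 0 ≤ ∫ t, (η t * ‖G (x - t)‖ ^ 2 - (2 * m) * (η t * ‖G (x - t)‖) + m ^ 2 * η t) :=
    integral_nonneg fun t => by
      have := mul_nonneg (hη0 t) (sq_nonneg (‖G (x - t)‖ - m))
      simp only [Pi.zero_apply]
      nlinarith
  rw [integral_add (by exact i2.sub (i1.const_mul _)) (i0.const_mul _),
    integral_sub i2 (i1.const_mul _), integral_const_mul, integral_const_mul,
    hη, φ.integral_normed, ← hη, ← hm] at h2
  have h3 : convolution η (fun y => ‖G y‖ ^ 2) (ContinuousLinearMap.lsmul ℝ ℝ) volume x =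
    ∫ t, η t * ‖G (x - t)‖ ^ 2 := rfl
  rw [h3]
  nlinarith [pow_le_pow_left₀ (norm_nonneg _) h1 2]

/-- Mollifications of an `L²` function converge to it in `L²`. -/
theorem tendsto_integral_norm_sub_convolution_sq [CompleteSpace F] {φ : ℕ → ContDiffBump (0 : E)} {K : ℝ}
    (hφ : Tendsto (fun n => (φ n).rOut) atTop (nhds 0))
    (hφ' : ∀ n, (φ n).rOut ≤ K * (φ n).rIn) {G : E → F}
    (hG : MemLp G 2 (volume : Measure E)) :
    (∀ n, Integrable (fun x => ‖G x - convolution ((φ n).normed volume) G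
        (ContinuousLinearMap.lsmul ℝ ℝ) volume x‖ ^ 2) (volume : Measure E)) ∧
    Tendsto (fun n => ∫ x, ‖G x - convolution ((φ n).normed volume) G
        (ContinuousLinearMap.lsmul ℝ ℝ) volume x‖ ^ 2) atTop (nhds 0) := by
  have hGl : LocallyIntegrable G (volume : Measure E) := hG.locallyIntegrable (by norm_num)
  have hsq : Integrable (fun y => ‖G y‖ ^ 2) (volume : Measure E) :=
    (memLp_two_iff_integrable_sq_norm hG.1).1 hG
  have hconv : ∀ n, Integrable (convolution ((φ n).normed volume) (fun y => ‖G y‖ ^ 2)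
      (ContinuousLinearMap.lsmul ℝ ℝ) volume) (volume : Measure E) := fun n =>
    (φ n).integrable_normed.integrable_convolution _ hsq
  have hmeas : ∀ n, AEStronglyMeasurable (fun x => ‖G x - convolution ((φ n).normed volume) G
        (ContinuousLinearMap.lsmul ℝ ℝ) volume x‖ ^ 2) (volume : Measure E) := fun n =>
    ((hG.1.sub ((φ n).hasCompactSupport_normed.continuous_convolution_left _
      (φ n).continuous_normed hGl).aestronglyMeasurable).norm.pow 2)
  have hF : ∀ n, Integrable (fun x => 2 * ‖G x‖ ^ 2 + 2 * convolution ((φ n).normed volume)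
      (fun y => ‖G y‖ ^ 2) (ContinuousLinearMap.lsmul ℝ ℝ) volume x) (volume : Measure E) :=
    fun n => (hsq.const_mul 2).add ((hconv n).const_mul 2)
  have hle : ∀ n x, ‖G x - convolution ((φ n).normed volume) G
        (ContinuousLinearMap.lsmul ℝ ℝ) volume x‖ ^ 2 ≤
      2 * ‖G x‖ ^ 2 + 2 * convolution ((φ n).normed volume)
      (fun y => ‖G y‖ ^ 2) (ContinuousLinearMap.lsmul ℝ ℝ) volume x := fun n x => by
    have h1 := (φ n).norm_convolution_sq_le hG x
    have h2 := norm_sub_le (G x) (convolution ((φ n).normed volume) G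
        (ContinuousLinearMap.lsmul ℝ ℝ) volume x)
    have h3 := pow_le_pow_left₀ (norm_nonneg _) h2 2
    nlinarith [sq_nonneg (‖G x‖ - ‖convolution ((φ n).normed volume) G
        (ContinuousLinearMap.lsmul ℝ ℝ) volume x‖)]
  refine ⟨fun n => (hF n).mono' (hmeas n) (.of_forall fun x => ?_), ?_⟩
  · rw [Real.norm_of_nonneg (by positivity)]
    exact hle n x
  refine tendsto_integral_zero_of_le_tendsto (H := fun x => 4 * ‖G x‖ ^ 2) hmeas
    (fun n x => by positivity) hle hF (hsq.const_mul 4) ?_ ?_ ?_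
  · filter_upwards [ContDiffBump.ae_convolution_tendsto_right_of_locallyIntegrable hφ
      (.of_forall hφ') hGl] with x hx
    simpa using (hx.const_sub (G x)).norm.pow 2
  · filter_upwards [ContDiffBump.ae_convolution_tendsto_right_of_locallyIntegrable hφ
      (.of_forall hφ') hsq.locallyIntegrable] with x hx
    convert (hx.const_mul 2).const_add (2 * ‖G x‖ ^ 2) using 2
    ring
  · refine (tendsto_const_nhds).congr fun n => ?_
    rw [integral_add (hsq.const_mul 2) ((hconv n).const_mul 2), integral_const_mul,
      integral_const_mul, integral_const_mul,
      integral_convolution (ContinuousLinearMap.lsmul ℝ ℝ) (φ n).integrable_normed hsq,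
      (φ n).integral_normed]
    simp
    ring

theorem convolution_indicator_closedBall_eq {φ : ContDiffBump (0 : E)} {g : E → F} {x : E} {r : ℝ}
    (hx : ‖x‖ + φ.rOut ≤ r) :
    convolution (φ.normed volume) ((Metric.closedBall 0 r).indicator g)
        (ContinuousLinearMap.lsmul ℝ ℝ) volume x =
      convolution (φ.normed volume) g (ContinuousLinearMap.lsmul ℝ ℝ) volume x := by
  rw [convolution_def, convolution_def]
  refine integral_congr_ae (.of_forall fun t => ?_)
  by_cases ht : t ∈ Metric.ball (0 : E) φ.rOut
  · have : x - t ∈ Metric.closedBall (0 : E) r := by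
      rw [mem_closedBall_zero_iff]
      rw [mem_ball_zero_iff] at ht
      linarith [norm_sub_le x t]
    simp [this]
  · rw [← φ.support_normed_eq (μ := volume), Function.notMem_support] at ht
    simp [ht]

end Mollification

/-- Mollification commutes with the weak gradient. -/
theorem HasWeakGradient.hasGradientAt_convolution {N : ℕ} {ψ : EuclideanSpace ℝ (Fin N) → ℝ}
    {g : EuclideanSpace ℝ (Fin N) → EuclideanSpace ℝ (Fin N)} (h : HasWeakGradient N ψ g)
    {η : EuclideanSpace ℝ (Fin N) → ℝ} (hη : ContDiff ℝ (⊤ : ℕ∞) η) (hηs : HasCompactSupport η)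
    (x : EuclideanSpace ℝ (Fin N)) :
    HasGradientAt (convolution η ψ (ContinuousLinearMap.lsmul ℝ ℝ) volume)
      (convolution η g (ContinuousLinearMap.lsmul ℝ ℝ) volume x) x := by
  obtain ⟨hψ, hg, hw⟩ := h
  have hη1 : ContDiff ℝ 1 η := hη.of_le (by exact_mod_cast le_top)
  have hd := hηs.hasFDerivAt_convolution_left (ContinuousLinearMap.lsmul ℝ ℝ) hη1 hψ x
  rw [hasGradientAt_iff_hasFDerivAt]
  suffices hdual : InnerProductSpace.toDual ℝ (EuclideanSpace ℝ (Fin N))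
      (convolution η g (ContinuousLinearMap.lsmul ℝ ℝ) volume x) =
      convolution (fderiv ℝ η) ψ (ContinuousLinearMap.precompL (EuclideanSpace ℝ (Fin N))
        (ContinuousLinearMap.lsmul ℝ ℝ)) volume x by
    rw [hdual]
    exact hd
  have hi1 := ((hηs.fderiv ℝ).convolutionExists_left (μ := volume)
    (ContinuousLinearMap.precompL (EuclideanSpace ℝ (Fin N)) (ContinuousLinearMap.lsmul ℝ ℝ))
    (hη1.continuous_fderiv one_ne_zero) hψ x).integrable_swap
  have hi2 : Integrable (fun t => η (x - t) • g t) volume :=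
    (hηs.convolutionExists_left (ContinuousLinearMap.lsmul ℝ ℝ) hη.continuous hg x).integrable_swap
  apply ContinuousLinearMap.coe_injective
  apply (EuclideanSpace.basisFun (Fin N) ℝ).toBasis.ext
  intro i
  simp only [OrthonormalBasis.coe_toBasis, EuclideanSpace.basisFun_apply,
    ContinuousLinearMap.coe_coe, InnerProductSpace.toDual_apply_apply]
  rw [convolution_eq_swap, convolution_eq_swap, ContinuousLinearMap.integral_apply hi1,
    EuclideanSpace.inner_single_right]
  simp only [ContinuousLinearMap.lsmul_apply, ContinuousLinearMap.precompL_apply, smul_eq_mul,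
    conj_trivial, one_mul]
  have hi3 : (∫ t, η (x - t) • g t) i = ∫ t, (η (x - t) • g t) i :=
    ((EuclideanSpace.proj (𝕜 := ℝ) i).integral_comp_comm hi2).symm
  have hsub : ContDiff ℝ (⊤ : ℕ∞) fun t => η (x - t) := hη.comp (contDiff_const.sub contDiff_id)
  have hsubs : HasCompactSupport fun t => η (x - t) :=
    hηs.comp_homeomorph (Homeomorph.subLeft x)
  have key := hw i _ hsub hsubs
  have hder : ∀ t, fderiv ℝ (fun t => η (x - t)) t = -fderiv ℝ η (x - t) := fun t => by
    have h1 : HasFDerivAt η (fderiv ℝ η (x - t)) (x - t) :=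
      (hη1.differentiable one_ne_zero _).hasFDerivAt
    have h2 : HasFDerivAt (fun t => x - t) (-ContinuousLinearMap.id ℝ _) t := by
      simpa using (hasFDerivAt_id (𝕜 := ℝ) t).const_sub x
    refine (h1.comp t h2).fderiv.trans ?_
    ext; simp
  rw [hi3]
  simp only [hder, neg_apply, mul_neg, integral_neg, neg_inj] at key
  simp only [PiLp.smul_apply, smul_eq_mul]
  simp_rw [mul_comm (η _), mul_comm (fderiv ℝ η _ _)]
  exact key.symm

section Truncation

variable {E : Type*} [NormedAddCommGroup E] [InnerProductSpace ℝ E]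

/-- The smooth truncation `c * arctan (s / c)`. -/
def arctanTrunc (c s : ℝ) : ℝ := c * arctan (s / c)

theorem contDiff_arctanTrunc (c : ℝ) : ContDiff ℝ (⊤ : ℕ∞) (arctanTrunc c) :=
  contDiff_const.mul (contDiff_arctan.comp (contDiff_id.div_const c))

theorem abs_arctanTrunc_le {c : ℝ} (hc : 0 < c) (s : ℝ) : |arctanTrunc c s| ≤ 2 * c := by
  have h1 : |arctan (s / c)| ≤ 2 := by
    rw [abs_le]
    constructor <;>
      linarith [arctan_lt_pi_div_two (s / c), neg_pi_div_two_lt_arctan (s / c), pi_le_four]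
  rw [arctanTrunc, abs_mul, abs_of_pos hc]
  nlinarith

theorem hasDerivAt_arctanTrunc {c : ℝ} (hc : 0 < c) (s : ℝ) :
    HasDerivAt (arctanTrunc c) (1 / (1 + (s / c) ^ 2)) s := by
  have h := ((hasDerivAt_arctan (s / c)).comp s ((hasDerivAt_id s).div_const c)).const_mul c
  refine h.congr_deriv ?_
  field_simp

/-- The standard bump function, equal to one on the unit ball and supported in the ball of
radius two, rescaled by `r`. -/
def scaledBump [HasContDiffBump E] (r : ℝ) (x : E) : ℝ :=
  (⟨1, 2, one_pos, one_lt_two⟩ : ContDiffBump (0 : E)) (r⁻¹ • x)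

theorem contDiff_scaledBump [FiniteDimensional ℝ E] (r : ℝ) :
    ContDiff ℝ (⊤ : ℕ∞) (scaledBump r : E → ℝ) :=
  (ContDiffBump.contDiff _).comp (contDiff_const_smul r⁻¹)

theorem scaledBump_nonneg [FiniteDimensional ℝ E] (r : ℝ) (x : E) : 0 ≤ scaledBump r x :=
  ContDiffBump.nonneg _

theorem scaledBump_le_one [FiniteDimensional ℝ E] (r : ℝ) (x : E) : scaledBump r x ≤ 1 :=
  ContDiffBump.le_one _

theorem scaledBump_eq_zero [FiniteDimensional ℝ E] {r : ℝ} (hr : 0 < r) {x : E}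
    (hx : 2 * r ≤ ‖x‖) : scaledBump r x = 0 := by
  refine ContDiffBump.zero_of_le_dist _ ?_
  rw [dist_zero_right, norm_smul, norm_inv, Real.norm_of_nonneg hr.le, inv_mul_eq_div,
    le_div_iff₀ hr]
  exact hx

theorem tendsto_scaledBump [FiniteDimensional ℝ E] {r : ℕ → ℝ} (hr : Tendsto r atTop atTop)
    (x : E) : Tendsto (fun n => scaledBump (r n) x) atTop (nhds 1) := by
  have h : Tendsto (fun n => (r n)⁻¹ • x) atTop (nhds 0) := by
    simpa using (tendsto_inv_atTop_zero.comp hr).smul_const x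
  have h' := ((⟨1, 2, one_pos, one_lt_two⟩ : ContDiffBump (0 : E)).continuous.tendsto 0).comp h
  rwa [ContDiffBump.one_of_mem_closedBall _ (Metric.mem_closedBall_self (by norm_num))] at h'

theorem exists_hasGradientAt_scaledBump [FiniteDimensional ℝ E] :
    ∃ C : ℝ, ∀ r : ℝ, 0 < r → ∀ x : E,
      ∃ v : E, HasGradientAt (scaledBump r) v x ∧ ‖v‖ ≤ C / r := by
  let f : ContDiffBump (0 : E) := ⟨1, 2, one_pos, one_lt_two⟩
  have hf : ContDiff ℝ 1 f := f.contDiff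
  obtain ⟨C, hC⟩ := (f.hasCompactSupport.fderiv ℝ).exists_bound_of_continuous
    (hf.continuous_fderiv one_ne_zero)
  refine ⟨C, fun r hr x =>
    ⟨(InnerProductSpace.toDual ℝ E).symm (r⁻¹ • fderiv ℝ f (r⁻¹ • x)), ?_, ?_⟩⟩
  · rw [hasGradientAt_iff_hasFDerivAt, LinearIsometryEquiv.apply_symm_apply]
    have h1 : HasFDerivAt f (fderiv ℝ f (r⁻¹ • x)) (r⁻¹ • x) :=
      (hf.differentiable one_ne_zero _).hasFDerivAt
    refine (h1.comp x ((hasFDerivAt_id (𝕜 := ℝ) x).const_smul r⁻¹)).congr_fderiv ?_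
    ext
    simp
  · rw [LinearIsometryEquiv.norm_map, norm_smul, norm_inv, Real.norm_of_nonneg hr.le,
      div_eq_inv_mul]
    gcongr
    exact hC _

theorem HasGradientAt.mul_comp_hasDerivAt [CompleteSpace E] {χ u : E → ℝ} {T : ℝ → ℝ} {v p x : E}
    {t : ℝ} (hχ : HasGradientAt χ v x) (hT : HasDerivAt T t (u x)) (hu : HasGradientAt u p x) :
    HasGradientAt (fun y => χ y * T (u y)) ((χ x * t) • p + T (u x) • v) x := by
  rw [hasGradientAt_iff_hasFDerivAt] at *
  refine (hχ.mul (hT.comp_hasFDerivAt x hu)).congr_fderiv ?_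
  ext
  simp
  ring

theorem norm_sub_smul_add_smul_sq_le (p q v : E) (a s : ℝ) :
    ‖p - (a • q + s • v)‖ ^ 2 ≤
      3 * ((1 - a) ^ 2 * ‖p‖ ^ 2 + a ^ 2 * ‖p - q‖ ^ 2 + s ^ 2 * ‖v‖ ^ 2) := by
  have h : p - (a • q + s • v) = (1 - a) • p + a • (p - q) - s • v := by module
  have h1 := (norm_sub_le ((1 - a) • p + a • (p - q)) (s • v)).trans
    (add_le_add_left (norm_add_le ((1 - a) • p) (a • (p - q))) _)
  rw [← h] at h1
  have h2 := pow_le_pow_left₀ (norm_nonneg _) h1 2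
  have h3 : ∀ (c : ℝ) (z : E), c ^ 2 * ‖z‖ ^ 2 = ‖c • z‖ ^ 2 := fun c z => by
    rw [norm_smul, mul_pow, Real.norm_eq_abs, sq_abs]
  rw [h3, h3, h3]
  nlinarith [sq_nonneg (‖(1 - a) • p‖ - ‖a • (p - q)‖), sq_nonneg (‖(1 - a) • p‖ - ‖s • v‖),
    sq_nonneg (‖a • (p - q)‖ - ‖s • v‖)]

end Truncation

section Gaussian

variable {E : Type*} [NormedAddCommGroup E] [InnerProductSpace ℝ E] [FiniteDimensional ℝ E]
  [MeasurableSpace E] [BorelSpace E]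

theorem integrable_exp_neg_norm_sq_div_two :
    Integrable (fun x : E => rexp (-‖x‖ ^ 2 / 2)) := by
  refine Integrable.of_integral_ne_zero ?_
  have h := GaussianFourier.integral_rexp_neg_mul_sq_norm (V := E) (b := 1 / 2) (by norm_num)
  have h' : (fun x : E => rexp (-‖x‖ ^ 2 / 2)) = fun x => rexp (-(1 / 2) * ‖x‖ ^ 2) := by
    ext; ring_nf
  rw [h', h]
  positivity

theorem memLp_two_indicator_closedBall {F : Type*} [NormedAddCommGroup F] {g : E → F}
    (hg : AEStronglyMeasurable g volume)
    (hgi : Integrable (fun x => rexp (-‖x‖ ^ 2 / 2) * ‖g x‖ ^ 2)) {r : ℝ} :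
    MemLp ((Metric.closedBall 0 r).indicator g) 2 (volume : Measure E) := by
  have hm := hg.indicator (Metric.isClosed_closedBall (x := (0 : E)) (ε := r)).measurableSet
  rw [memLp_two_iff_integrable_sq_norm hm]
  refine (hgi.const_mul (rexp (r ^ 2 / 2))).mono' (hm.norm.pow 2) (.of_forall fun x => ?_)
  rw [Real.norm_of_nonneg (by positivity), ← mul_assoc, ← Real.exp_add]
  by_cases hx : x ∈ Metric.closedBall (0 : E) r
  · rw [Set.indicator_of_mem hx]
    rw [mem_closedBall_zero_iff] at hx
    have h1 := pow_le_pow_left₀ (norm_nonneg _) hx 2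
    have h2 : 1 ≤ rexp (r ^ 2 / 2 + -‖x‖ ^ 2 / 2) := Real.one_le_exp (by linarith)
    exact le_mul_of_one_le_left (by positivity) h2
  · rw [Set.indicator_of_notMem hx]
    simp
    positivity

theorem lintegral_ofReal_lt_of_le {α : Type*} [MeasurableSpace α] {μ : Measure α} {f h : α → ℝ}
    {ε : ℝ} (hfh : ∀ x, f x ≤ h x) (hf : ∀ x, 0 ≤ f x) (hh : Integrable h μ)
    (hε : ∫ x, h x ∂μ < ε) : ∫⁻ x, ENNReal.ofReal (f x) ∂μ < ENNReal.ofReal ε := by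
  have h0 : ∀ x, 0 ≤ h x := fun x => (hf x).trans (hfh x)
  refine (lintegral_mono fun x => ENNReal.ofReal_le_ofReal (hfh x)).trans_lt ?_
  rw [← ofReal_integral_eq_lintegral_ofReal hh (.of_forall h0)]
  exact ENNReal.ofReal_lt_ofReal_iff'.2 ⟨hε, (integral_nonneg h0).trans_lt hε⟩

end Gaussian

/-- Bounded smooth functions are dense in the Gaussian-weighted homogeneous
Sobolev space: if `ψ` is locally integrable with weak gradient `g` satisfying
`∫ e^{-|x|²/2}|g|² dx < ∞`, then for every `ε > 0` there is a smooth bounded `φ` with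
`∫ e^{-|x|²/2}|g - ∇φ|² dx < ε`. -/
theorem stmt6 (N : ℕ) (hN : 1 ≤ N)
    (ψ : EuclideanSpace ℝ (Fin N) → ℝ)
    (g : EuclideanSpace ℝ (Fin N) → EuclideanSpace ℝ (Fin N))
    (hwg : HasWeakGradient N ψ g)
    (hfin : (∫⁻ x, ENNReal.ofReal (Real.exp (-‖x‖ ^ 2 / 2) * ‖g x‖ ^ 2)) < ⊤) :
    ∀ ε : ℝ, 0 < ε →
      ∃ φ : EuclideanSpace ℝ (Fin N) → ℝ, ContDiff ℝ (⊤ : ℕ∞) φ ∧ (∃ M : ℝ, ∀ x, |φ x| ≤ M) ∧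
        (∫⁻ x, ENNReal.ofReal (Real.exp (-‖x‖ ^ 2 / 2) * ‖g x - gradient φ x‖ ^ 2))
          < ENNReal.ofReal ε := by
  intro ε hε
  have hψ := hwg.1
  have hψm := hψ.aestronglyMeasurable
  have hgm := hwg.2.1.aestronglyMeasurable
  have hwc : Continuous fun x : EuclideanSpace ℝ (Fin N) => rexp (-‖x‖ ^ 2 / 2) := by fun_prop
  have hgi : Integrable (fun x => rexp (-‖x‖ ^ 2 / 2) * ‖g x‖ ^ 2) := by
    refine ⟨hwc.aestronglyMeasurable.mul (hgm.norm.pow 2), ?_⟩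
    rw [hasFiniteIntegral_iff_ofReal (.of_forall fun x => by positivity)]
    exact hfin
  have hw := integrable_exp_neg_norm_sq_div_two (E := EuclideanSpace ℝ (Fin N))
  obtain ⟨C, hC⟩ := exists_hasGradientAt_scaledBump (E := EuclideanSpace ℝ (Fin N))
  let b : ℕ → ContDiffBump (0 : EuclideanSpace ℝ (Fin N)) := fun n =>
    ⟨1 / ((n : ℝ) + 1) / 2, 1 / ((n : ℝ) + 1), by positivity, half_lt_self (by positivity)⟩
  have hb : Tendsto (fun n => (b n).rOut) atTop (nhds 0) := tendsto_one_div_add_atTop_nhds_zero_nat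
  have hb' : ∀ n, (b n).rOut ≤ 2 * (b n).rIn := fun n => by
    change 1 / ((n : ℝ) + 1) ≤ 2 * (1 / ((n : ℝ) + 1) / 2)
    linarith
  have hb1 : ∀ n, (b n).rOut ≤ 1 := fun n => by
    change 1 / ((n : ℝ) + 1) ≤ 1
    rw [div_le_one (by positivity)]
    linarith [n.cast_nonneg (α := ℝ)]
  let u : ℕ → EuclideanSpace ℝ (Fin N) → ℝ := fun n =>
    convolution ((b n).normed volume) ψ (ContinuousLinearMap.lsmul ℝ ℝ) volume
  have hu : ∀ n, ContDiff ℝ (⊤ : ℕ∞) (u n) := fun n =>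
    (b n).hasCompactSupport_normed.contDiff_convolution_left _ (b n).contDiff_normed hψ
  have hu_lim : ∀ᵐ x, Tendsto (fun n => u n x) atTop (nhds (ψ x)) :=
    ContDiffBump.ae_convolution_tendsto_right_of_locallyIntegrable hb (.of_forall hb') hψ
  -- `a c v x` is the factor multiplying the gradient of `v` in the truncation at scale `c`.
  let a : ℝ → (EuclideanSpace ℝ (Fin N) → ℝ) → EuclideanSpace ℝ (Fin N) → ℝ :=
    fun c v x => scaledBump (c ^ 2) x * (1 / (1 + (v x / c) ^ 2))
  have ha : ∀ c v x, 0 ≤ a c v x ∧ a c v x ≤ 1 := fun c v x => by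
    have h1 : 1 / (1 + (v x / c) ^ 2) ≤ 1 := by
      rw [div_le_one (by positivity)]
      linarith [sq_nonneg (v x / c)]
    exact ⟨mul_nonneg (scaledBump_nonneg _ _) (by positivity),
      mul_le_one₀ (scaledBump_le_one _ _) (by positivity) h1⟩
  have ha_bound : ∀ c v x, ‖(1 - a c v x) ^ 2 * (rexp (-‖x‖ ^ 2 / 2) * ‖g x‖ ^ 2)‖ ≤
      rexp (-‖x‖ ^ 2 / 2) * ‖g x‖ ^ 2 := fun c v x => by
    rw [Real.norm_of_nonneg (by positivity)]
    exact mul_le_of_le_one_left (by positivity)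
      (pow_le_one₀ (by linarith [(ha c v x).2]) (by linarith [(ha c v x).1]))
  have ha_meas : ∀ c v, AEStronglyMeasurable v volume → AEStronglyMeasurable
      (fun x => (1 - a c v x) ^ 2 * (rexp (-‖x‖ ^ 2 / 2) * ‖g x‖ ^ 2)) volume := by
    intro c v hv
    have h1 : Continuous fun s : ℝ => 1 / (1 + (s / c) ^ 2) :=
      continuous_const.div (by fun_prop) fun s => by positivity
    exact ((aestronglyMeasurable_const.sub
      ((contDiff_scaledBump (c ^ 2)).continuous.aestronglyMeasurable.mul
        (h1.comp_aestronglyMeasurable hv))).pow 2).mul hgi.aestronglyMeasurable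
  have hκ : Tendsto (fun k : ℕ => (k : ℝ) + 1) atTop atTop :=
    tendsto_atTop_add_const_right _ _ tendsto_natCast_atTop_atTop
  have hJ : Tendsto (fun k : ℕ => ∫ x, (1 - a ((k : ℝ) + 1) ψ x) ^ 2 *
      (rexp (-‖x‖ ^ 2 / 2) * ‖g x‖ ^ 2)) atTop (nhds 0) := by
    rw [← integral_zero (EuclideanSpace ℝ (Fin N)) ℝ (μ := volume)]
    refine tendsto_integral_of_dominated_convergence _ (fun k => ha_meas _ _ hψm) hgi
      (fun k => .of_forall fun x => ha_bound _ _ x) (.of_forall fun x => ?_)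
    have h1 := tendsto_scaledBump ((tendsto_pow_atTop two_ne_zero).comp hκ) x
    have h2 : Tendsto (fun k : ℕ => 1 / (1 + (ψ x / ((k : ℝ) + 1)) ^ 2)) atTop (nhds 1) := by
      have h3 := ((hκ.const_div_atTop (ψ x)).pow 2).const_add 1
      simpa using h3.inv₀ (by norm_num)
    simpa [a] using (((h1.mul h2).const_sub 1).pow 2).mul_const (rexp (-‖x‖ ^ 2 / 2) * ‖g x‖ ^ 2)
  have hrem : Tendsto (fun k : ℕ => 4 * C ^ 2 / ((k : ℝ) + 1) ^ 2 *
      ∫ x : EuclideanSpace ℝ (Fin N), rexp (-‖x‖ ^ 2 / 2)) atTop (nhds 0) := by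
    simpa using (((tendsto_pow_atTop two_ne_zero).comp hκ).const_div_atTop
      (4 * C ^ 2)).mul_const (∫ x : EuclideanSpace ℝ (Fin N), rexp (-‖x‖ ^ 2 / 2))
  obtain ⟨k, hk⟩ := ((hJ.add hrem).eventually_lt_const
    (show (0 : ℝ) + 0 < ε / 3 by linarith)).exists
  set c : ℝ := (k : ℝ) + 1
  have hc0 : 0 < c := by positivity
  have hI : Tendsto (fun n : ℕ => ∫ x, (1 - a c (u n) x) ^ 2 *
      (rexp (-‖x‖ ^ 2 / 2) * ‖g x‖ ^ 2)) atTop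
      (nhds (∫ x, (1 - a c ψ x) ^ 2 * (rexp (-‖x‖ ^ 2 / 2) * ‖g x‖ ^ 2))) := by
    refine tendsto_integral_of_dominated_convergence _
      (fun n => ha_meas _ _ (hu n).continuous.aestronglyMeasurable) hgi
      (fun n => .of_forall fun x => ha_bound _ _ x) ?_
    filter_upwards [hu_lim] with x hx
    have h1 : Continuous fun s : ℝ => (1 - scaledBump (c ^ 2) x * (1 / (1 + (s / c) ^ 2))) ^ 2 *
        (rexp (-‖x‖ ^ 2 / 2) * ‖g x‖ ^ 2) := by
      have h2 : Continuous fun s : ℝ => 1 / (1 + (s / c) ^ 2) :=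
        continuous_const.div (by fun_prop) fun s => by positivity
      fun_prop
    exact (h1.tendsto (ψ x)).comp hx
  obtain ⟨hDi, hD⟩ := tendsto_integral_norm_sub_convolution_sq hb hb'
    (memLp_two_indicator_closedBall hgm hgi (r := 2 * c ^ 2 + 1))
  obtain ⟨n, hn⟩ := (((hI.add hD).add_const (4 * C ^ 2 / c ^ 2 *
    ∫ x : EuclideanSpace ℝ (Fin N), rexp (-‖x‖ ^ 2 / 2))).eventually_lt_const
    (show _ < ε / 3 by rw [add_zero]; exact hk)).exists
  refine ⟨fun x => scaledBump (c ^ 2) x * arctanTrunc c (u n x),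
    (contDiff_scaledBump _).mul ((contDiff_arctanTrunc c).comp (hu n)), ⟨2 * c, fun x => ?_⟩, ?_⟩
  · rw [abs_mul, abs_of_nonneg (scaledBump_nonneg _ _)]
    exact (mul_le_of_le_one_left (abs_nonneg _) (scaledBump_le_one _ _)).trans
      (abs_arctanTrunc_le hc0 _)
  have hIi : Integrable fun x => (1 - a c (u n) x) ^ 2 * (rexp (-‖x‖ ^ 2 / 2) * ‖g x‖ ^ 2) :=
    hgi.mono' (ha_meas _ _ (hu n).continuous.aestronglyMeasurable)
      (.of_forall fun x => ha_bound _ _ x)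
  refine lintegral_ofReal_lt_of_le (fun x => ?_) (fun x => by positivity)
    (((hIi.add (hDi n)).add (hw.const_mul (4 * C ^ 2 / c ^ 2))).const_mul 3) ?_
  · obtain ⟨v, hv, hvn⟩ := hC (c ^ 2) (by positivity) x
    have hgrad := hv.mul_comp_hasDerivAt (hasDerivAt_arctanTrunc hc0 (u n x))
      (hwg.hasGradientAt_convolution (b n).contDiff_normed (b n).hasCompactSupport_normed x)
    rw [hgrad.gradient]
    set q := convolution ((b n).normed volume) g (ContinuousLinearMap.lsmul ℝ ℝ) volume x with hq
    have hw1 : rexp (-‖x‖ ^ 2 / 2) ≤ 1 := Real.exp_le_one_iff.2 (by nlinarith [sq_nonneg ‖x‖])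
    have h1 := mul_le_mul_of_nonneg_left (norm_sub_smul_add_smul_sq_le (g x) q v (a c (u n) x)
      (arctanTrunc c (u n x))) (Real.exp_pos (-‖x‖ ^ 2 / 2)).le
    refine h1.trans ?_
    have h2 : rexp (-‖x‖ ^ 2 / 2) * (a c (u n) x ^ 2 * ‖g x - q‖ ^ 2) ≤
        ‖(Metric.closedBall 0 (2 * c ^ 2 + 1)).indicator g x -
          convolution ((b n).normed volume) ((Metric.closedBall 0 (2 * c ^ 2 + 1)).indicator g)
            (ContinuousLinearMap.lsmul ℝ ℝ) volume x‖ ^ 2 := by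
      rcases le_or_gt (2 * c ^ 2) ‖x‖ with hx | hx
      · have : a c (u n) x = 0 := by simp only [a, scaledBump_eq_zero (by positivity) hx, zero_mul]
        rw [this]
        simp
      · rw [convolution_indicator_closedBall_eq (by linarith [hb1 n]), ← hq,
          Set.indicator_of_mem (by rw [mem_closedBall_zero_iff]; linarith)]
        have h3 : a c (u n) x ^ 2 ≤ 1 := pow_le_one₀ (ha _ _ _).1 (ha _ _ _).2
        rw [← mul_assoc]
        exact mul_le_of_le_one_left (by positivity) (mul_le_one₀ hw1 (by positivity) h3)
    have h4 : arctanTrunc c (u n x) ^ 2 * ‖v‖ ^ 2 ≤ 4 * C ^ 2 / c ^ 2 := by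
      have h5 : arctanTrunc c (u n x) ^ 2 ≤ (2 * c) ^ 2 :=
        sq_le_sq' (neg_le_of_abs_le (abs_arctanTrunc_le hc0 _))
          (le_of_abs_le (abs_arctanTrunc_le hc0 _))
      calc _ ≤ (2 * c) ^ 2 * (C / c ^ 2) ^ 2 := by gcongr
        _ = 4 * C ^ 2 / c ^ 2 := by field_simp; ring
    have h6 := mul_le_mul_of_nonneg_left h4 (Real.exp_pos (-‖x‖ ^ 2 / 2)).le
    simp only [Pi.add_apply]
    linarith
  · rw [integral_const_mul, integral_add' (hIi.add (hDi n)) (hw.const_mul _),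
      integral_add' hIi (hDi n), integral_const_mul]
    linarith
end
end

section
/- There exists a constant C > 0, depending only on the dimension N ≥ 1, such that for every locally integrable function ψ : ℝ^N → ℝ with weak gradient satisfying ∫_{ℝ^N} e^{-|x|²/2} |∇ψ|² dx < ∞, one has inf_{c ∈ ℝ} ∫_{ℝ^N} (1 + |x|²) e^{-|x|²/2} (ψ(x) - c)² dx ≤ C ∫_{ℝ^N} e^{-|x|²/2} |∇ψ(x)|² dx. -/
open MeasureTheory Real Filter ENNReal

noncomputable section

theorem sq_lintegral_mul_le {α : Type*} [MeasurableSpace α] {μ : Measure α} {k f : α → ℝ≥0∞}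
    (hk : AEMeasurable k μ) (hf : AEMeasurable f μ) :
    (∫⁻ x, k x * f x ∂μ) ^ 2 ≤ (∫⁻ x, k x ∂μ) * ∫⁻ x, k x * f x ^ 2 ∂μ := by
  have key := ENNReal.lintegral_mul_le_Lp_mul_Lq μ Real.HolderConjugate.two_two
    (f := fun x => k x ^ (1 / 2 : ℝ)) (g := fun x => k x ^ (1 / 2 : ℝ) * f x)
    (hk.pow_const _) ((hk.pow_const _).mul hf)
  have hsq : ∀ a : ℝ≥0∞, (a ^ (1 / 2 : ℝ)) ^ (2 : ℝ) = a := fun a => by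
    rw [← ENNReal.rpow_mul]; norm_num
  have hsq' : ∀ a : ℝ≥0∞, (a ^ (1 / 2 : ℝ)) ^ 2 = a := fun a => by
    rw [← ENNReal.rpow_two, hsq]
  have h1 : ∀ x, ((fun x => k x ^ (1 / 2 : ℝ)) * fun x => k x ^ (1 / 2 : ℝ) * f x) x
      = k x * f x := fun x => by
    simp only [Pi.mul_apply]
    rw [← mul_assoc, ← sq, hsq']
  simp only [h1, hsq, ENNReal.mul_rpow_of_nonneg _ _ (zero_le_two : (0 : ℝ) ≤ 2)] at key
  calc (∫⁻ x, k x * f x ∂μ) ^ 2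
      ≤ ((∫⁻ x, k x ∂μ) ^ (1 / 2 : ℝ) * (∫⁻ x, k x * f x ^ (2 : ℝ) ∂μ) ^ (1 / 2 : ℝ)) ^ 2 := by
        gcongr
    _ = _ := by
        rw [mul_pow, hsq', hsq']
        simp only [ENNReal.rpow_two]

section

variable {E : Type*} [NormedAddCommGroup E] [InnerProductSpace ℝ E]

theorem norm_sq_rotation (θ : ℝ) (x y : E) :
    ‖cos θ • x + sin θ • y‖ ^ 2 + ‖-sin θ • x + cos θ • y‖ ^ 2 = ‖x‖ ^ 2 + ‖y‖ ^ 2 := by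
  rw [norm_add_sq_real, norm_add_sq_real]
  simp only [norm_smul, inner_smul_left, inner_smul_right, mul_pow, Real.norm_eq_abs, sq_abs,
    neg_sq]
  simp
  linear_combination (‖x‖ ^ 2 + ‖y‖ ^ 2) * Real.sin_sq_add_cos_sq θ

theorem enorm_sub_le_lintegral_rotation {f : E → ℝ} (hf : ContDiff ℝ 1 f) (x y : E) :
    ‖f x - f y‖ₑ ≤ ∫⁻ θ in Set.Ioc 0 (π / 2),
      ‖fderiv ℝ f (cos θ • x + sin θ • y)‖ₑ * ‖-sin θ • x + cos θ • y‖ₑ := by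
  have hpath : ∀ θ : ℝ, HasDerivAt (fun θ => cos θ • x + sin θ • y)
      (-sin θ • x + cos θ • y) θ := fun θ =>
    ((Real.hasDerivAt_cos θ).smul_const x).add ((Real.hasDerivAt_sin θ).smul_const y)
  have hder : ∀ θ : ℝ, HasDerivAt (fun θ => f (cos θ • x + sin θ • y))
      (fderiv ℝ f (cos θ • x + sin θ • y) (-sin θ • x + cos θ • y)) θ := fun θ =>
    ((hf.differentiable one_ne_zero _).hasFDerivAt).comp_hasDerivAt θ (hpath θ)
  have hcont : Continuous fun θ : ℝ =>
      fderiv ℝ f (cos θ • x + sin θ • y) (-sin θ • x + cos θ • y) :=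
    ((hf.continuous_fderiv one_ne_zero).comp (by fun_prop)).clm_apply (by fun_prop)
  have key := intervalIntegral.integral_eq_sub_of_hasDerivAt (a := 0) (b := π / 2)
    (fun θ _ => hder θ) (hcont.intervalIntegrable _ _)
  simp only [Real.cos_pi_div_two, Real.sin_pi_div_two, Real.cos_zero, Real.sin_zero, zero_smul,
    one_smul, zero_add, add_zero] at key
  rw [← enorm_neg, neg_sub, ← key, intervalIntegral.integral_of_le (by positivity)]
  refine (enorm_integral_le_lintegral_enorm _).trans (lintegral_mono fun θ => ?_)
  exact ContinuousLinearMap.le_opENorm _ _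

variable [FiniteDimensional ℝ E] [MeasurableSpace E] [BorelSpace E]

theorem measurePreserving_rotation (θ : ℝ) :
    MeasurePreserving
      (fun p : E × E => (cos θ • p.1 + sin θ • p.2, -sin θ • p.1 + cos θ • p.2)) := by
  let L (θ : ℝ) : WithLp 2 (E × E) →ₗ[ℝ] WithLp 2 (E × E) :=
    { toFun := fun p => WithLp.toLp 2
        (cos θ • p.fst + sin θ • p.snd, -sin θ • p.fst + cos θ • p.snd)
      map_add' := fun p q => by
        apply (WithLp.ofLp_injective 2)
        ext <;> simp <;> module
      map_smul' := fun c p => by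
        apply (WithLp.ofLp_injective 2)
        ext <;> simp <;> module }
  have hL : ∀ θ, L θ ∘ₗ L (-θ) = LinearMap.id := fun θ => by
    refine LinearMap.ext fun p => WithLp.ofLp_injective 2 ?_
    have h := Real.sin_sq_add_cos_sq θ
    ext
    · simp only [L, LinearMap.comp_apply, LinearMap.coe_mk, AddHom.coe_mk, LinearMap.id_apply,
        Real.cos_neg, Real.sin_neg, WithLp.toLp_fst, WithLp.toLp_snd, WithLp.ofLp_fst]
      match_scalars <;> first | linear_combination h | ring
    · simp only [L, LinearMap.comp_apply, LinearMap.coe_mk, AddHom.coe_mk, LinearMap.id_apply,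
        Real.cos_neg, Real.sin_neg, WithLp.toLp_fst, WithLp.toLp_snd, WithLp.ofLp_snd]
      match_scalars <;> first | linear_combination h | ring
  let e : WithLp 2 (E × E) ≃ₗᵢ[ℝ] WithLp 2 (E × E) :=
    { LinearEquiv.ofLinearMap (L θ) (L (-θ)) (hL θ) (by simpa using hL (-θ)) with
      norm_map' := fun p => by
        rw [← sq_eq_sq₀ (norm_nonneg _) (norm_nonneg _), WithLp.prod_norm_sq_eq_of_L2,
          WithLp.prod_norm_sq_eq_of_L2]
        exact norm_sq_rotation θ p.fst p.snd }
  exact (WithLp.volume_preserving_ofLp E E).comp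
    (e.measurePreserving.comp (WithLp.volume_preserving_toLp E E))

open scoped Pointwise in
/-- The integral of a nonnegative function over the dilates of a star-shaped compact set is
nondecreasing in the dilation factor. -/
theorem integral_dilation_nonneg {V : Type*} [NormedAddCommGroup V] [NormedSpace ℝ V]
    [FiniteDimensional ℝ V] [MeasurableSpace V] [BorelSpace V] (μ : Measure V)
    [μ.IsAddHaarMeasure] {H : V → ℝ} (hH : ContDiff ℝ 1 H) (hH0 : ∀ z, 0 ≤ H z) {B : Set V}
    (hB : IsCompact B) (hstar : ∀ t ∈ Set.Ioo (0 : ℝ) 1, ∀ z ∈ B, t • z ∈ B) :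
    0 ≤ ∫ z in B, (Module.finrank ℝ V * H z + fderiv ℝ H z z) ∂μ := by
  set M := Module.finrank ℝ V
  have hBm : MeasurableSet B := hB.measurableSet
  have hdiff : Differentiable ℝ H := hH.differentiable one_ne_zero
  have hfc : Continuous (fderiv ℝ H) := hH.continuous_fderiv one_ne_zero
  let F : ℝ → V → ℝ := fun t z => t ^ M * H (t • z)
  let F' : ℝ → V → ℝ := fun t z => M * t ^ (M - 1) * H (t • z) + t ^ M * fderiv ℝ H (t • z) z
  have hF'c : Continuous (fun q : ℝ × V => F' q.1 q.2) := by
    have h1 : Continuous fun q : ℝ × V => q.1 • q.2 := by fun_prop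
    have h2 : Continuous fun q : ℝ × V => fderiv ℝ H (q.1 • q.2) q.2 :=
      (hfc.comp h1).clm_apply continuous_snd
    have h3 := hH.continuous.comp h1
    exact ((continuous_const.mul (continuous_fst.pow _)).mul h3).add
      ((continuous_fst.pow _).mul h2)
  have hFc : ∀ t, Continuous (F t) := fun t =>
    continuous_const.mul (hH.continuous.comp (continuous_const_smul t))
  obtain ⟨C, hC⟩ := ((isCompact_Icc (a := (0 : ℝ)) (b := 2)).prod hB).exists_bound_of_continuousOn
    hF'c.continuousOn
  have hF'1 : Continuous (F' 1) := hF'c.comp (Continuous.prodMk_right 1)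
  have hder : HasDerivAt (fun t => ∫ z in B, F t z ∂μ) (∫ z in B, F' 1 z ∂μ) 1 := by
    refine (hasDerivAt_integral_of_dominated_loc_of_deriv_le (bound := fun _ => C)
      (Icc_mem_nhds (a := (0 : ℝ)) (b := 2) (by norm_num) (by norm_num))
      (Eventually.of_forall fun t => (hFc t).aestronglyMeasurable)
      ((hFc 1).continuousOn.integrableOn_compact hB)
      hF'1.aestronglyMeasurable ?_ (by
        have : IsFiniteMeasure (μ.restrict B) := ⟨by simpa using hB.measure_lt_top⟩
        exact integrable_const C) ?_).2
    · exact (ae_restrict_iff' hBm).2 (Eventually.of_forall fun z hz t ht => hC (t, z) ⟨ht, hz⟩)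
    · refine Eventually.of_forall fun z t _ => ?_
      have h1 : HasDerivAt (fun t : ℝ => t • z) z t := by
        simpa using (hasDerivAt_id t).smul_const z
      exact (hasDerivAt_pow M t).mul ((hdiff (t • z)).hasFDerivAt.comp_hasDerivAt t h1)
  have hmono : ∀ t ∈ Set.Ioo (0 : ℝ) 1, ∫ z in B, F t z ∂μ ≤ ∫ z in B, F 1 z ∂μ := by
    intro t ht
    have e1 : ∫ z in B, F t z ∂μ = ∫ z in t • B, H z ∂μ := by
      simp only [F]
      rw [integral_const_mul, Measure.setIntegral_comp_smul_of_pos _ _ _ ht.1, smul_eq_mul,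
        ← mul_assoc, mul_inv_cancel₀ (pow_pos ht.1 _).ne', one_mul]
    rw [e1]
    simp only [F, one_pow, one_mul, one_smul]
    refine setIntegral_mono_set (hH.continuous.continuousOn.integrableOn_compact hB)
      (Eventually.of_forall hH0) (LE.le.eventuallyLE ?_)
    rintro _ ⟨z, hz, rfl⟩
    exact hstar t ht z hz
  have hlim := hder.hasDerivWithinAt (s := Set.Iio 1)
  rw [hasDerivWithinAt_iff_tendsto_slope' (by simp)] at hlim
  have h0 : 0 ≤ ∫ z in B, F' 1 z ∂μ := by
    refine ge_of_tendsto hlim ?_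
    filter_upwards [Ioo_mem_nhdsLT (zero_lt_one' ℝ)] with t ht
    rw [slope_def_field]
    exact div_nonneg_of_nonpos (sub_nonpos.2 (hmono t ht)) (by linarith [ht.2])
  simpa [F'] using h0

/-- A Gaussian-type Poincaré inequality for radial weights on `E × E`, obtained by integrating
along rotations. -/
theorem lintegral_enorm_sub_sq_le {f : E → ℝ} (hf : ContDiff ℝ 1 f) {k : ℝ → ℝ≥0∞}
    (hk : Measurable k) :
    ∫⁻ p : E × E, k (‖p.1‖ ^ 2 + ‖p.2‖ ^ 2) * ‖f p.1 - f p.2‖ₑ ^ 2 ≤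
      ENNReal.ofReal (π / 2) ^ 2 *
        ∫⁻ p : E × E, k (‖p.1‖ ^ 2 + ‖p.2‖ ^ 2) * (‖fderiv ℝ f p.1‖ₑ * ‖p.2‖ₑ) ^ 2 := by
  let φ : E × E → ℝ≥0∞ := fun p => ‖fderiv ℝ f p.1‖ₑ * ‖p.2‖ₑ
  let r : ℝ → E × E → E × E := fun θ p =>
    (cos θ • p.1 + sin θ • p.2, -sin θ • p.1 + cos θ • p.2)
  let K : E × E → ℝ≥0∞ := fun p => k (‖p.1‖ ^ 2 + ‖p.2‖ ^ 2)
  have hfc := hf.continuous_fderiv one_ne_zero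
  have hφ : Measurable φ :=
    (hfc.comp continuous_fst).enorm.measurable.mul continuous_snd.enorm.measurable
  have hK : Measurable K := hk.comp (by fun_prop)
  have hr : Measurable fun q : ℝ × (E × E) => r q.1 q.2 :=
    Continuous.measurable (by fun_prop)
  have hKr : ∀ θ p, K (r θ p) = K p := fun θ p => by
    simp only [K, r]
    rw [norm_sq_rotation]
  have hpt : ∀ p : E × E, ‖f p.1 - f p.2‖ₑ ^ 2 ≤
      ENNReal.ofReal (π / 2) * ∫⁻ θ in Set.Ioc 0 (π / 2), φ (r θ p) ^ 2 := fun p => by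
    have h1 := sq_lintegral_mul_le (μ := volume.restrict (Set.Ioc 0 (π / 2)))
      (k := fun _ => 1) (f := fun θ => φ (r θ p)) aemeasurable_const
      (hφ.comp (hr.comp measurable_prodMk_right)).aemeasurable
    simp only [one_mul, lintegral_one, Measure.restrict_apply_univ, Real.volume_Ioc,
      sub_zero] at h1
    refine le_trans ?_ h1
    gcongr
    exact enorm_sub_le_lintegral_rotation hf p.1 p.2
  calc ∫⁻ p, K p * ‖f p.1 - f p.2‖ₑ ^ 2
      ≤ ∫⁻ p, ENNReal.ofReal (π / 2) *
          ∫⁻ θ in Set.Ioc 0 (π / 2), K (r θ p) * φ (r θ p) ^ 2 := by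
        refine lintegral_mono fun p => ?_
        simp only [hKr]
        have hm : Measurable fun θ => φ (r θ p) ^ 2 :=
          (hφ.comp (hr.comp measurable_prodMk_right)).pow_const 2
        rw [lintegral_const_mul _ hm, mul_left_comm]
        gcongr
        exact hpt p
    _ = ENNReal.ofReal (π / 2) *
          ∫⁻ θ in Set.Ioc 0 (π / 2), ∫⁻ p, K (r θ p) * φ (r θ p) ^ 2 := by
        rw [lintegral_const_mul' _ _ ENNReal.ofReal_ne_top, lintegral_lintegral_swap]
        exact (((hK.mul (hφ.pow_const 2)).comp hr).comp measurable_swap).aemeasurable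
    _ = ENNReal.ofReal (π / 2) *
          ∫⁻ θ in Set.Ioc 0 (π / 2), ∫⁻ p, K p * φ p ^ 2 := by
        congr 1
        refine lintegral_congr fun θ => ?_
        exact (measurePreserving_rotation θ).lintegral_comp (hK.mul (hφ.pow_const 2))
    _ = _ := by
        rw [setLIntegral_const, Real.volume_Ioc, sub_zero]
        simp only [K, φ]
        ring

/-- Integrating the weight `‖p.1‖² + ‖p.2‖²` by parts against the Gaussian on a ball. -/
theorem lintegral_gaussian_mul_sq_le {f : E → ℝ} (hf : ContDiff ℝ 1 f) (R : ℝ) :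
    ∫⁻ p in {p : E × E | ‖p.1‖ ^ 2 + ‖p.2‖ ^ 2 ≤ R},
        ENNReal.ofReal (exp (-(‖p.1‖ ^ 2 + ‖p.2‖ ^ 2) / 2) *
          ((‖p.1‖ ^ 2 + ‖p.2‖ ^ 2) * (f p.1 - f p.2) ^ 2)) ≤
      ∫⁻ p in {p : E × E | ‖p.1‖ ^ 2 + ‖p.2‖ ^ 2 ≤ R},
        ENNReal.ofReal (exp (-(‖p.1‖ ^ 2 + ‖p.2‖ ^ 2) / 2) *
          (2 * Module.finrank ℝ (E × E) * (f p.1 - f p.2) ^ 2 +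
            4 * (‖fderiv ℝ f p.1‖ ^ 2 + ‖fderiv ℝ f p.2‖ ^ 2))) := by
  set B : Set (E × E) := {p | ‖p.1‖ ^ 2 + ‖p.2‖ ^ 2 ≤ R}
  set M := Module.finrank ℝ (E × E)
  have hBclosed : IsClosed B := isClosed_le (by fun_prop) continuous_const
  have hB : IsCompact B := by
    refine Metric.isCompact_of_isClosed_isBounded hBclosed
      ((Metric.isBounded_closedBall (x := (0 : E × E)) (r := 1 + R)).subset fun p hp => ?_)
    have hp' : ‖p.1‖ ^ 2 + ‖p.2‖ ^ 2 ≤ R := hp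
    rw [mem_closedBall_zero_iff, Prod.norm_def, max_le_iff]
    constructor <;> nlinarith [sq_nonneg (‖p.1‖ - 1), sq_nonneg (‖p.2‖ - 1), norm_nonneg p.1,
      norm_nonneg p.2]
  let H : E × E → ℝ := fun p => exp (-(‖p.1‖ ^ 2 + ‖p.2‖ ^ 2) / 2) * (f p.1 - f p.2) ^ 2
  have hfc := hf.continuous
  have hfd := hf.continuous_fderiv one_ne_zero
  have hH : ContDiff ℝ 1 H := by
    have h1 : ContDiff ℝ 1 fun p : E × E => ‖p.1‖ ^ 2 := contDiff_fst.norm_sq ℝ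
    have h2 : ContDiff ℝ 1 fun p : E × E => ‖p.2‖ ^ 2 := contDiff_snd.norm_sq ℝ
    have h3 := hf.comp (contDiff_fst (𝕜 := ℝ) (E := E) (F := E))
    have h4 := hf.comp (contDiff_snd (𝕜 := ℝ) (E := E) (F := E))
    exact (((h1.add h2).neg.div_const 2).exp).mul ((h3.sub h4).pow 2)
  have hHd : ∀ p : E × E, fderiv ℝ H p p = exp (-(‖p.1‖ ^ 2 + ‖p.2‖ ^ 2) / 2) *
      (-(‖p.1‖ ^ 2 + ‖p.2‖ ^ 2) * (f p.1 - f p.2) ^ 2 +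
        2 * (f p.1 - f p.2) * (fderiv ℝ f p.1 p.1 - fderiv ℝ f p.2 p.2)) := fun p => by
    have h1 : HasDerivAt (fun t : ℝ => t • p) p 1 := by
      simpa using (hasDerivAt_id (1 : ℝ)).smul_const p
    have h11 : HasDerivAt (fun t : ℝ => t • p.1) p.1 1 := by
      simpa using (hasDerivAt_id (1 : ℝ)).smul_const p.1
    have h12 : HasDerivAt (fun t : ℝ => t • p.2) p.2 1 := by
      simpa using (hasDerivAt_id (1 : ℝ)).smul_const p.2
    have hcomp : HasDerivAt (fun t : ℝ => H (t • p)) (fderiv ℝ H p p) 1 := by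
      have := (hH.differentiable one_ne_zero ((1 : ℝ) • p)).hasFDerivAt.comp_hasDerivAt 1 h1
      rwa [one_smul] at this
    have hf1 : HasDerivAt (fun t : ℝ => f (t • p.1)) (fderiv ℝ f p.1 p.1) 1 := by
      have := (hf.differentiable one_ne_zero ((1 : ℝ) • p.1)).hasFDerivAt.comp_hasDerivAt 1 h11
      rwa [one_smul] at this
    have hf2 : HasDerivAt (fun t : ℝ => f (t • p.2)) (fderiv ℝ f p.2 p.2) 1 := by
      have := (hf.differentiable one_ne_zero ((1 : ℝ) • p.2)).hasFDerivAt.comp_hasDerivAt 1 h12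
      rwa [one_smul] at this
    have hexp : HasDerivAt (fun t : ℝ => exp (-(‖t • p.1‖ ^ 2 + ‖t • p.2‖ ^ 2) / 2))
        (exp (-(‖p.1‖ ^ 2 + ‖p.2‖ ^ 2) / 2) * -(‖p.1‖ ^ 2 + ‖p.2‖ ^ 2)) 1 := by
      have h : HasDerivAt (fun t : ℝ => -(t ^ 2 * (‖p.1‖ ^ 2 + ‖p.2‖ ^ 2)) / 2)
          (-(‖p.1‖ ^ 2 + ‖p.2‖ ^ 2)) 1 := by
        have := (((hasDerivAt_pow 2 (1 : ℝ)).mul_const (‖p.1‖ ^ 2 + ‖p.2‖ ^ 2)).neg).div_const 2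
        exact this.congr_deriv (by push_cast; ring)
      have h' := h.exp
      simp only [one_pow, one_mul] at h'
      convert h' using 2 with t
      simp only [norm_smul, mul_pow, Real.norm_eq_abs, sq_abs]
      ring_nf
    have hprod := hexp.mul ((hf1.sub hf2).pow 2)
    rw [hcomp.unique hprod]
    simp
    ring
  have hstar : ∀ t ∈ Set.Ioo (0 : ℝ) 1, ∀ z ∈ B, t • z ∈ B := fun t ht p hp => by
    have hp' : ‖p.1‖ ^ 2 + ‖p.2‖ ^ 2 ≤ R := hp
    change ‖t • p.1‖ ^ 2 + ‖t • p.2‖ ^ 2 ≤ R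
    simp only [norm_smul, mul_pow, Real.norm_eq_abs, sq_abs]
    have : t ^ 2 ≤ 1 := by nlinarith [ht.1, ht.2]
    nlinarith [sq_nonneg ‖p.1‖, sq_nonneg ‖p.2‖]
  have : (volume : Measure (E × E)).IsAddHaarMeasure := by
    rw [Measure.volume_eq_prod]
    infer_instance
  have key := integral_dilation_nonneg (volume : Measure (E × E)) hH (fun p => by positivity) hB
    hstar
  have hc1 : Continuous fun p : E × E => f p.1 - f p.2 := by fun_prop
  have hc2 : Continuous fun p : E × E => ‖fderiv ℝ f p.1‖ ^ 2 + ‖fderiv ℝ f p.2‖ ^ 2 :=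
    ((hfd.comp continuous_fst).norm.pow 2).add ((hfd.comp continuous_snd).norm.pow 2)
  have hc3 : Continuous fun p : E × E => exp (-(‖p.1‖ ^ 2 + ‖p.2‖ ^ 2) / 2) := by fun_prop
  have hi1 : IntegrableOn (fun p : E × E => exp (-(‖p.1‖ ^ 2 + ‖p.2‖ ^ 2) / 2) *
        ((‖p.1‖ ^ 2 + ‖p.2‖ ^ 2) * (f p.1 - f p.2) ^ 2)) B :=
    (hc3.mul (Continuous.mul (by fun_prop) (hc1.pow 2))).continuousOn.integrableOn_compact hB
  have hi2 : IntegrableOn (fun p : E × E => exp (-(‖p.1‖ ^ 2 + ‖p.2‖ ^ 2) / 2) *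
        (2 * M * (f p.1 - f p.2) ^ 2 +
          4 * (‖fderiv ℝ f p.1‖ ^ 2 + ‖fderiv ℝ f p.2‖ ^ 2))) B :=
    (hc3.mul ((continuous_const.mul (hc1.pow 2)).add
      (continuous_const.mul hc2))).continuousOn.integrableOn_compact hB
  have hi3 : IntegrableOn (fun p : E × E => M * H p + fderiv ℝ H p p) B :=
    ((continuous_const.mul hH.continuous).add ((hH.continuous_fderiv one_ne_zero).clm_apply
      continuous_id)).continuousOn.integrableOn_compact hB
  rw [← ofReal_integral_eq_lintegral_ofReal hi1 (Eventually.of_forall fun p => by positivity),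
    ← ofReal_integral_eq_lintegral_ofReal hi2 (Eventually.of_forall fun p => by positivity)]
  refine ENNReal.ofReal_le_ofReal ?_
  rw [← sub_nonneg, ← integral_sub hi2 hi1]
  refine (mul_nonneg zero_le_two key).trans ?_
  rw [← integral_const_mul]
  refine integral_mono (hi3.const_mul 2) (hi2.sub hi1) fun p => ?_
  simp only [hHd, H]
  have ha : |fderiv ℝ f p.1 p.1| ≤ ‖fderiv ℝ f p.1‖ * ‖p.1‖ := (fderiv ℝ f p.1).le_opNorm p.1
  have hb : |fderiv ℝ f p.2 p.2| ≤ ‖fderiv ℝ f p.2‖ * ‖p.2‖ := (fderiv ℝ f p.2).le_opNorm p.2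
  generalize fderiv ℝ f p.1 p.1 = A at *
  generalize fderiv ℝ f p.2 p.2 = A' at *
  generalize ‖fderiv ℝ f p.1‖ = a at *
  generalize ‖fderiv ℝ f p.2‖ = a' at *
  generalize f p.1 - f p.2 = g at *
  have hineq : 4 * g * (A - A') ≤ (‖p.1‖ ^ 2 + ‖p.2‖ ^ 2) * g ^ 2 + 4 * (a ^ 2 + a' ^ 2) := by
    have h1 : g * A ≤ |g| * (a * ‖p.1‖) := (le_abs_self _).trans (by rw [abs_mul]; gcongr)
    have h2 : -(g * A') ≤ |g| * (a' * ‖p.2‖) := (neg_le_abs _).trans (by rw [abs_mul]; gcongr)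
    nlinarith [sq_nonneg (|g| * ‖p.1‖ - 2 * a), sq_nonneg (|g| * ‖p.2‖ - 2 * a'), sq_abs g]
  have := mul_le_mul_of_nonneg_left hineq (exp_pos (-(‖p.1‖ ^ 2 + ‖p.2‖ ^ 2) / 2)).le
  nlinarith

end

section

theorem ofReal_exp_neg_add_sq {E : Type*} [NormedAddCommGroup E] (x y : E) :
    ENNReal.ofReal (exp (-(‖x‖ ^ 2 + ‖y‖ ^ 2) / 2)) =
      ENNReal.ofReal (exp (-‖x‖ ^ 2 / 2)) * ENNReal.ofReal (exp (-‖y‖ ^ 2 / 2)) := by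
  rw [← ENNReal.ofReal_mul (exp_pos _).le, ← Real.exp_add]
  ring_nf

variable (E : Type*) [NormedAddCommGroup E] [InnerProductSpace ℝ E]
variable [FiniteDimensional ℝ E] [MeasurableSpace E] [BorelSpace E]

theorem lintegral_one_add_sq_mul_gaussian_lt_top :
    ∫⁻ x : E, ENNReal.ofReal ((1 + ‖x‖ ^ 2) * exp (-‖x‖ ^ 2 / 2)) < ⊤ := by
  have hint : Integrable fun x : E => 4 * exp (-(1 / 4) * ‖x‖ ^ 2) := by
    have h := (GaussianFourier.integrable_cexp_neg_mul_sq_norm_add (V := E) (b := 1 / 4)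
      (by norm_num) 0 0).norm.const_mul 4
    refine h.congr (Eventually.of_forall fun x => ?_)
    simp [Complex.norm_exp, ← Complex.ofReal_pow]
  refine lt_of_le_of_lt (lintegral_mono fun x => ENNReal.ofReal_le_ofReal ?_)
    hint.lintegral_lt_top
  have h1 : 1 + ‖x‖ ^ 2 ≤ 4 * exp (‖x‖ ^ 2 / 4) := by
    have := Real.add_one_le_exp (‖x‖ ^ 2 / 4)
    linarith
  calc (1 + ‖x‖ ^ 2) * exp (-‖x‖ ^ 2 / 2)
      ≤ 4 * exp (‖x‖ ^ 2 / 4) * exp (-‖x‖ ^ 2 / 2) := by gcongr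
    _ = 4 * exp (-(1 / 4) * ‖x‖ ^ 2) := by
        rw [mul_assoc, ← Real.exp_add]
        ring_nf

theorem exists_lintegral_ball_gaussian_sub_sq_le :
    ∃ C : ℝ≥0∞, C ≠ ⊤ ∧ ∀ (f : E → ℝ) (R : ℝ), ContDiff ℝ 1 f → 0 ≤ R →
      ∫⁻ p in {p : E × E | ‖p.1‖ ^ 2 + ‖p.2‖ ^ 2 ≤ R ^ 2},
          ENNReal.ofReal (exp (-(‖p.1‖ ^ 2 + ‖p.2‖ ^ 2) / 2) *
            ((1 + (‖p.1‖ ^ 2 + ‖p.2‖ ^ 2)) * (f p.1 - f p.2) ^ 2)) ≤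
        C * ∫⁻ x in Metric.closedBall (0 : E) R,
          ENNReal.ofReal (exp (-‖x‖ ^ 2 / 2)) * ‖fderiv ℝ f x‖ₑ ^ 2 := by
  set m : ℝ≥0∞ := ∫⁻ x : E, ENNReal.ofReal ((1 + ‖x‖ ^ 2) * exp (-‖x‖ ^ 2 / 2)) with hm
  have hmtop : m ≠ ⊤ := (lintegral_one_add_sq_mul_gaussian_lt_top E).ne
  set M : ℝ≥0∞ := ENNReal.ofReal (2 * Module.finrank ℝ (E × E)) with hM
  refine ⟨(1 + M) * (ENNReal.ofReal (π / 2) ^ 2 * m) + 4 * (m + m), by finiteness, ?_⟩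
  intro f R hf hR
  set B : Set (E × E) := {p | ‖p.1‖ ^ 2 + ‖p.2‖ ^ 2 ≤ R ^ 2} with hBdef
  have hBm : MeasurableSet B := measurableSet_le (by fun_prop) measurable_const
  let w : E → ℝ≥0∞ := fun x => ENNReal.ofReal (exp (-‖x‖ ^ 2 / 2))
  let D : E → ℝ≥0∞ :=
    (Metric.closedBall (0 : E) R).indicator fun x => w x * ‖fderiv ℝ f x‖ₑ ^ 2
  let W : E × E → ℝ≥0∞ := fun p => ENNReal.ofReal (exp (-(‖p.1‖ ^ 2 + ‖p.2‖ ^ 2) / 2))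
  have hW : ∀ p, W p = w p.1 * w p.2 := fun p => ofReal_exp_neg_add_sq p.1 p.2
  have hwm : Measurable w := by fun_prop
  have hfd : Measurable fun x => ‖fderiv ℝ f x‖ₑ :=
    (hf.continuous_fderiv one_ne_zero).enorm.measurable
  have hDm : Measurable D := (hwm.mul (hfd.pow_const 2)).indicator measurableSet_closedBall
  have hD : ∫⁻ x, D x = ∫⁻ x in Metric.closedBall (0 : E) R, w x * ‖fderiv ℝ f x‖ₑ ^ 2 :=
    lintegral_indicator measurableSet_closedBall _
  rw [← hD]
  have hnorm : ∀ x : E, ENNReal.ofReal (‖x‖ ^ 2) = ‖x‖ₑ ^ 2 := fun x => by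
    rw [ENNReal.ofReal_pow (norm_nonneg _), ofReal_norm]
  have hw1 : ∫⁻ x, w x ≤ m := lintegral_mono fun x => ENNReal.ofReal_le_ofReal
    (le_mul_of_one_le_left (exp_pos _).le (by nlinarith [sq_nonneg ‖x‖]))
  have hw2 : ∫⁻ x, w x * ‖x‖ₑ ^ 2 ≤ m := lintegral_mono fun x => by
    simp only [w]
    rw [← hnorm, ← ENNReal.ofReal_mul (exp_pos _).le]
    refine ENNReal.ofReal_le_ofReal ?_
    nlinarith [exp_pos (-‖x‖ ^ 2 / 2)]
  have hB1 : ∀ p ∈ B, p.1 ∈ Metric.closedBall (0 : E) R := fun p hp => by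
    have hp' : ‖p.1‖ ^ 2 + ‖p.2‖ ^ 2 ≤ R ^ 2 := hp
    rw [mem_closedBall_zero_iff]
    exact le_of_sq_le_sq (by nlinarith [sq_nonneg ‖p.2‖]) hR
  have hB2 : ∀ p ∈ B, p.2 ∈ Metric.closedBall (0 : E) R := fun p hp => by
    have hp' : ‖p.1‖ ^ 2 + ‖p.2‖ ^ 2 ≤ R ^ 2 := hp
    rw [mem_closedBall_zero_iff]
    exact le_of_sq_le_sq (by nlinarith [sq_nonneg ‖p.1‖]) hR
  have hprod : ∀ u v : E → ℝ≥0∞, Measurable u → Measurable v →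
      ∫⁻ p : E × E, u p.1 * v p.2 = (∫⁻ x, u x) * ∫⁻ y, v y := fun u v hu hv => by
    rw [Measure.volume_eq_prod, lintegral_prod_mul hu.aemeasurable hv.aemeasurable]
  have hA : ∫⁻ p in B, W p * ‖f p.1 - f p.2‖ₑ ^ 2 ≤
      ENNReal.ofReal (π / 2) ^ 2 * m * ∫⁻ x, D x := by
    let k : ℝ → ℝ≥0∞ := (Set.Iic (R ^ 2)).indicator fun s => ENNReal.ofReal (exp (-s / 2))
    have hk : Measurable k := Measurable.indicator (by fun_prop) measurableSet_Iic
    have hkW : ∀ p : E × E, k (‖p.1‖ ^ 2 + ‖p.2‖ ^ 2) = B.indicator W p := fun p => by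
      by_cases hp : p ∈ B
      · rw [Set.indicator_of_mem hp]
        exact Set.indicator_of_mem (by exact hp) _
      · rw [Set.indicator_of_notMem hp]
        exact Set.indicator_of_notMem (by exact hp) _
    have h := lintegral_enorm_sub_sq_le hf hk
    simp only [hkW] at h
    calc ∫⁻ p in B, W p * ‖f p.1 - f p.2‖ₑ ^ 2
        = ∫⁻ p, B.indicator W p * ‖f p.1 - f p.2‖ₑ ^ 2 := by
          rw [← lintegral_indicator hBm]
          exact lintegral_congr fun p => Set.indicator_mul_left B W _
      _ ≤ _ := h
      _ ≤ ENNReal.ofReal (π / 2) ^ 2 * ∫⁻ p : E × E, D p.1 * (w p.2 * ‖p.2‖ₑ ^ 2) := by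
          gcongr ENNReal.ofReal (π / 2) ^ 2 * ?_
          refine lintegral_mono fun p => ?_
          by_cases hp : p ∈ B
          · simp only [D]
            rw [Set.indicator_of_mem hp, Set.indicator_of_mem (hB1 p hp), hW]
            exact le_of_eq (by ring)
          · rw [Set.indicator_of_notMem hp, zero_mul]
            exact zero_le
      _ ≤ _ := by
          rw [hprod D (fun y => w y * ‖y‖ₑ ^ 2) hDm (hwm.mul (measurable_enorm.pow_const 2)),
            mul_assoc, mul_comm m]
          gcongr
  have hG1 : ∫⁻ p in B, W p * ‖fderiv ℝ f p.1‖ₑ ^ 2 ≤ m * ∫⁻ x, D x := by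
    calc ∫⁻ p in B, W p * ‖fderiv ℝ f p.1‖ₑ ^ 2
        ≤ ∫⁻ p in B, D p.1 * w p.2 := by
          refine setLIntegral_mono' hBm fun p hp => ?_
          simp only [D]
          rw [Set.indicator_of_mem (hB1 p hp), hW]
          exact le_of_eq (by ring)
      _ ≤ ∫⁻ p : E × E, D p.1 * w p.2 := setLIntegral_le_lintegral _ _
      _ ≤ _ := by
          rw [hprod D w hDm hwm, mul_comm]
          gcongr
  have hG2 : ∫⁻ p in B, W p * ‖fderiv ℝ f p.2‖ₑ ^ 2 ≤ m * ∫⁻ x, D x := by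
    calc ∫⁻ p in B, W p * ‖fderiv ℝ f p.2‖ₑ ^ 2
        ≤ ∫⁻ p in B, w p.1 * D p.2 := by
          refine setLIntegral_mono' hBm fun p hp => ?_
          simp only [D]
          rw [Set.indicator_of_mem (hB2 p hp), hW]
          exact le_of_eq (by ring)
      _ ≤ ∫⁻ p : E × E, w p.1 * D p.2 := setLIntegral_le_lintegral _ _
      _ ≤ _ := by
          rw [hprod w D hwm hDm]
          gcongr
  have hWm : Measurable W := by fun_prop
  have hsub : ∀ p : E × E, ENNReal.ofReal ((f p.1 - f p.2) ^ 2) = ‖f p.1 - f p.2‖ₑ ^ 2 :=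
    fun p => by rw [← sq_abs, ENNReal.ofReal_pow (abs_nonneg _), ← Real.norm_eq_abs, ofReal_norm]
  have hfm : Measurable f := hf.continuous.measurable
  have hfm2 : Measurable fun p : E × E => W p * ‖f p.1 - f p.2‖ₑ ^ 2 := by fun_prop
  have hm1 : Measurable fun p : E × E => W p * ‖fderiv ℝ f p.1‖ₑ ^ 2 :=
    hWm.mul ((hfd.comp measurable_fst).pow_const 2)
  have hrad : ∫⁻ p in B, ENNReal.ofReal (exp (-(‖p.1‖ ^ 2 + ‖p.2‖ ^ 2) / 2) *
        ((‖p.1‖ ^ 2 + ‖p.2‖ ^ 2) * (f p.1 - f p.2) ^ 2)) ≤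
      M * (∫⁻ p in B, W p * ‖f p.1 - f p.2‖ₑ ^ 2) +
        4 * ((∫⁻ p in B, W p * ‖fderiv ℝ f p.1‖ₑ ^ 2) +
          ∫⁻ p in B, W p * ‖fderiv ℝ f p.2‖ₑ ^ 2) := by
    refine (lintegral_gaussian_mul_sq_le hf (R ^ 2)).trans (le_of_eq ?_)
    have hd : ∀ x, ENNReal.ofReal (‖fderiv ℝ f x‖ ^ 2) = ‖fderiv ℝ f x‖ₑ ^ 2 := fun x => by
      rw [ENNReal.ofReal_pow (norm_nonneg _), ofReal_norm]
    rw [← lintegral_add_left hm1, ← lintegral_const_mul' M _ ENNReal.ofReal_ne_top,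
      ← lintegral_const_mul' 4 _ (by finiteness), ← lintegral_add_left (hfm2.const_mul _)]
    refine lintegral_congr fun p => ?_
    rw [ENNReal.ofReal_mul (exp_pos _).le, ENNReal.ofReal_add (by positivity) (by positivity),
      ENNReal.ofReal_mul (p := 2 * (Module.finrank ℝ (E × E) : ℝ)) (by positivity),
      ENNReal.ofReal_mul (p := (4 : ℝ)) (by norm_num),
      ENNReal.ofReal_add (by positivity) (by positivity), hd, hd, hsub, ENNReal.ofReal_ofNat]
    simp only [W, hM]
    ring
  calc ∫⁻ p in B, ENNReal.ofReal (exp (-(‖p.1‖ ^ 2 + ‖p.2‖ ^ 2) / 2) *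
            ((1 + (‖p.1‖ ^ 2 + ‖p.2‖ ^ 2)) * (f p.1 - f p.2) ^ 2))
      = (∫⁻ p in B, W p * ‖f p.1 - f p.2‖ₑ ^ 2) +
          ∫⁻ p in B, ENNReal.ofReal (exp (-(‖p.1‖ ^ 2 + ‖p.2‖ ^ 2) / 2) *
            ((‖p.1‖ ^ 2 + ‖p.2‖ ^ 2) * (f p.1 - f p.2) ^ 2)) := by
        rw [← lintegral_add_left hfm2]
        refine lintegral_congr fun p => ?_
        rw [add_mul, one_mul, mul_add, ENNReal.ofReal_add (by positivity) (by positivity),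
          ENNReal.ofReal_mul (exp_pos _).le, hsub]
    _ ≤ ENNReal.ofReal (π / 2) ^ 2 * m * (∫⁻ x, D x) +
          (M * (ENNReal.ofReal (π / 2) ^ 2 * m * ∫⁻ x, D x) +
            4 * (m * (∫⁻ x, D x) + m * ∫⁻ x, D x)) := by
        refine add_le_add hA (hrad.trans ?_)
        gcongr
    _ = _ := by ring

end

section

open scoped Convolution

variable {N : ℕ} {ψ : EuclideanSpace ℝ (Fin N) → ℝ}
  {g : EuclideanSpace ℝ (Fin N) → EuclideanSpace ℝ (Fin N)}

theorem HasWeakGradient.fderiv_convolution (h : HasWeakGradient N ψ g)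
    {ρ : EuclideanSpace ℝ (Fin N) → ℝ} (hρ : ContDiff ℝ (⊤ : ℕ∞) ρ) (hρc : HasCompactSupport ρ)
    (x v : EuclideanSpace ℝ (Fin N)) :
    fderiv ℝ (ρ ⋆[ContinuousLinearMap.lsmul ℝ ℝ, volume] ψ) x v =
      inner ℝ (∫ t, ρ (x - t) • g t) v := by
  obtain ⟨hψ, hg, hweak⟩ := h
  have hρ1 : ContDiff ℝ 1 ρ := hρ.of_le (by exact_mod_cast le_top)
  have hφ : ContDiff ℝ (⊤ : ℕ∞) fun t => ρ (x - t) := hρ.comp (contDiff_const.sub contDiff_id)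
  have hφc : HasCompactSupport fun t => ρ (x - t) :=
    hρc.comp_homeomorph (Homeomorph.subLeft x)
  have hint : Integrable fun t => ρ (x - t) • g t :=
    hg.integrable_smul_left_of_hasCompactSupport hφ.continuous hφc
  have hcoord : ∀ i : Fin N,
      fderiv ℝ (ρ ⋆[ContinuousLinearMap.lsmul ℝ ℝ, volume] ψ) x (EuclideanSpace.single i 1) =
        (∫ t, ρ (x - t) • g t) i := fun i => by
    have hL := (hρc.hasFDerivAt_convolution_left (ContinuousLinearMap.lsmul ℝ ℝ) hρ1 hψ x).fderiv
    have hex := ((hρc.fderiv ℝ).convolutionExists_left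
      ((ContinuousLinearMap.lsmul ℝ ℝ).precompL (EuclideanSpace ℝ (Fin N)))
      (hρ1.continuous_fderiv one_ne_zero) hψ x).integrable_swap
    rw [hL, convolution_eq_swap, ContinuousLinearMap.integral_apply hex]
    have hderiv : ∀ t, fderiv ℝ (fun t => ρ (x - t)) t (EuclideanSpace.single i 1) =
        -fderiv ℝ ρ (x - t) (EuclideanSpace.single i 1) := fun t => by
      have h1 : HasFDerivAt (fun t => x - t)
          (-ContinuousLinearMap.id ℝ (EuclideanSpace ℝ (Fin N))) t := (hasFDerivAt_id t).const_sub x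
      have h2 := ((hρ1.differentiable one_ne_zero (x - t)).hasFDerivAt).comp t h1
      rw [show (fun t => ρ (x - t)) = ρ ∘ fun t => x - t from rfl, h2.fderiv]
      simp
    have hw := hweak i _ hφ hφc
    simp only [hderiv, mul_neg, integral_neg, neg_inj] at hw
    have hproj : ∫ t, ρ (x - t) * g t i = (∫ t, ρ (x - t) • g t) i :=
      (EuclideanSpace.proj (𝕜 := ℝ) i).integral_comp_comm hint
    rw [← hproj]
    calc _ = ∫ t, ψ t * fderiv ℝ ρ (x - t) (EuclideanSpace.single i 1) := by
          refine integral_congr_ae (Eventually.of_forall fun t => ?_)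
          simp [ContinuousLinearMap.precompL_apply, mul_comm]
      _ = _ := by
          rw [hw]
          simp only [mul_comm]
  have hv : v = ∑ i, v i • EuclideanSpace.single i (1 : ℝ) := by
    simpa using ((EuclideanSpace.basisFun (Fin N) ℝ).sum_repr v).symm
  conv_lhs => rw [hv]
  simp only [map_sum, map_smul, hcoord, smul_eq_mul, PiLp.inner_apply]
  exact Finset.sum_congr rfl fun i _ => by simp

theorem HasWeakGradient.enorm_fderiv_convolution_sq_le (h : HasWeakGradient N ψ g)
    (b : ContDiffBump (0 : EuclideanSpace ℝ (Fin N))) (x : EuclideanSpace ℝ (Fin N)) :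
    ‖fderiv ℝ (b.normed volume ⋆[ContinuousLinearMap.lsmul ℝ ℝ, volume] ψ) x‖ₑ ^ 2 ≤
      ∫⁻ t, ‖b.normed volume (x - t)‖ₑ * ‖g t‖ₑ ^ 2 := by
  have hmass : ∫⁻ t, ‖b.normed volume (x - t)‖ₑ = 1 := by
    rw [lintegral_sub_left_eq_self (fun t => ‖b.normed volume t‖ₑ) x,
      ← ofReal_integral_norm_eq_lintegral_enorm b.integrable_normed]
    simp only [Real.norm_of_nonneg (b.nonneg_normed _), b.integral_normed, ENNReal.ofReal_one]
  have hle : ‖fderiv ℝ (b.normed volume ⋆[ContinuousLinearMap.lsmul ℝ ℝ, volume] ψ) x‖ₑ ≤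
      ‖∫ t, b.normed volume (x - t) • g t‖ₑ := by
    rw [enorm_le_iff_norm_le]
    refine ContinuousLinearMap.opNorm_le_bound _ (norm_nonneg _) fun v => ?_
    rw [h.fderiv_convolution b.contDiff_normed b.hasCompactSupport_normed]
    exact norm_inner_le_norm _ _
  have hk : Continuous fun t => b.normed volume (x - t) :=
    b.continuous_normed.comp (continuous_const.sub continuous_id)
  have hcs := sq_lintegral_mul_le (μ := volume) (k := fun t => ‖b.normed volume (x - t)‖ₑ)
    (f := fun t => ‖g t‖ₑ) hk.enorm.measurable.aemeasurable
    h.2.1.aestronglyMeasurable.enorm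
  rw [hmass, one_mul] at hcs
  refine le_trans ?_ hcs
  gcongr
  refine hle.trans ((enorm_integral_le_lintegral_enorm _).trans (le_of_eq ?_))
  simp only [enorm_smul]

theorem HasWeakGradient.lintegral_gaussian_fderiv_convolution_le (h : HasWeakGradient N ψ g)
    (b : ContDiffBump (0 : EuclideanSpace ℝ (Fin N))) {R : ℝ}
    (hR : R * b.rOut + b.rOut ^ 2 / 2 ≤ 2) :
    ∫⁻ x in Metric.closedBall (0 : EuclideanSpace ℝ (Fin N)) R,
        ENNReal.ofReal (exp (-‖x‖ ^ 2 / 2)) *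
          ‖fderiv ℝ (b.normed volume ⋆[ContinuousLinearMap.lsmul ℝ ℝ, volume] ψ) x‖ₑ ^ 2 ≤
      ENNReal.ofReal (exp 2) * ∫⁻ x, ENNReal.ofReal (exp (-‖x‖ ^ 2 / 2) * ‖g x‖ ^ 2) := by
  let ρ := b.normed (volume : Measure (EuclideanSpace ℝ (Fin N)))
  have hmass : ∀ t, ∫⁻ x, ‖ρ (x - t)‖ₑ = 1 := fun t => by
    rw [lintegral_sub_right_eq_self (fun t => ‖ρ t‖ₑ) t,
      ← ofReal_integral_norm_eq_lintegral_enorm b.integrable_normed]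
    simp only [Real.norm_of_nonneg (b.nonneg_normed _), b.integral_normed, ENNReal.ofReal_one]
  have hg : AEMeasurable (fun t => ‖g t‖ₑ) := h.2.1.aestronglyMeasurable.enorm
  have hweight : ∀ x ∈ Metric.closedBall (0 : EuclideanSpace ℝ (Fin N)) R, ∀ t,
      ENNReal.ofReal (exp (-‖x‖ ^ 2 / 2)) * ‖ρ (x - t)‖ₑ ≤
        ENNReal.ofReal (exp 2) * (ENNReal.ofReal (exp (-‖t‖ ^ 2 / 2)) * ‖ρ (x - t)‖ₑ) := by
    intro x hx t
    by_cases hxt : x - t ∈ Metric.ball (0 : EuclideanSpace ℝ (Fin N)) b.rOut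
    · rw [← mul_assoc, ← ENNReal.ofReal_mul (exp_pos _).le, ← Real.exp_add]
      gcongr
      rw [mem_ball_zero_iff] at hxt
      rw [mem_closedBall_zero_iff] at hx
      have h1 : ‖t‖ ≤ ‖x‖ + ‖x - t‖ := by
        calc ‖t‖ = ‖x - (x - t)‖ := by rw [_root_.sub_sub_cancel]
          _ ≤ _ := norm_sub_le _ _
      have h2 : ‖t‖ ≤ ‖x‖ + b.rOut := by linarith
      have h3 : ‖t‖ ^ 2 ≤ (‖x‖ + b.rOut) ^ 2 := by gcongr
      have h4 : ‖x‖ * b.rOut ≤ R * b.rOut := by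
        gcongr
        exact b.rOut_pos.le
      nlinarith
    · have : ρ (x - t) = 0 := by
        rw [← Function.notMem_support, b.support_normed_eq]
        exact hxt
      simp [this]
  calc ∫⁻ x in Metric.closedBall (0 : EuclideanSpace ℝ (Fin N)) R,
        ENNReal.ofReal (exp (-‖x‖ ^ 2 / 2)) *
          ‖fderiv ℝ (ρ ⋆[ContinuousLinearMap.lsmul ℝ ℝ, volume] ψ) x‖ₑ ^ 2
      ≤ ∫⁻ x in Metric.closedBall (0 : EuclideanSpace ℝ (Fin N)) R, ENNReal.ofReal (exp 2) *
          ∫⁻ t, ENNReal.ofReal (exp (-‖t‖ ^ 2 / 2)) * ‖ρ (x - t)‖ₑ * ‖g t‖ₑ ^ 2 := by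
        refine setLIntegral_mono' measurableSet_closedBall fun x hx => ?_
        calc _ ≤ ENNReal.ofReal (exp (-‖x‖ ^ 2 / 2)) * ∫⁻ t, ‖ρ (x - t)‖ₑ * ‖g t‖ₑ ^ 2 := by
              gcongr
              exact h.enorm_fderiv_convolution_sq_le b x
          _ ≤ _ := by
              rw [← lintegral_const_mul' _ _ ENNReal.ofReal_ne_top,
                ← lintegral_const_mul' _ _ ENNReal.ofReal_ne_top]
              refine lintegral_mono fun t => ?_
              calc _ = ENNReal.ofReal (exp (-‖x‖ ^ 2 / 2)) * ‖ρ (x - t)‖ₑ * ‖g t‖ₑ ^ 2 := by ring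
                _ ≤ _ := mul_le_mul' (hweight x hx t) le_rfl
                _ = _ := by ring
    _ ≤ ∫⁻ x, ENNReal.ofReal (exp 2) *
          ∫⁻ t, ENNReal.ofReal (exp (-‖t‖ ^ 2 / 2)) * ‖ρ (x - t)‖ₑ * ‖g t‖ₑ ^ 2 :=
        setLIntegral_le_lintegral _ _
    _ = ENNReal.ofReal (exp 2) *
          ∫⁻ t, ∫⁻ x, ENNReal.ofReal (exp (-‖t‖ ^ 2 / 2)) * ‖ρ (x - t)‖ₑ * ‖g t‖ₑ ^ 2 := by
        rw [lintegral_const_mul' _ _ ENNReal.ofReal_ne_top, lintegral_lintegral_swap]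
        have h1 : Measurable fun p : EuclideanSpace ℝ (Fin N) × EuclideanSpace ℝ (Fin N) =>
            ENNReal.ofReal (exp (-‖p.2‖ ^ 2 / 2)) * ‖ρ (p.1 - p.2)‖ₑ := by
          have : Measurable ρ := b.continuous_normed.measurable
          fun_prop
        exact h1.aemeasurable.mul (hg.comp_snd.pow_const 2)
    _ = _ := by
        congr 1
        refine lintegral_congr fun t => ?_
        have hρm : Measurable fun x => ‖ρ (x - t)‖ₑ :=
          (b.continuous_normed.comp (continuous_id.sub continuous_const)).enorm.measurable
        rw [lintegral_mul_const _ (hρm.const_mul _), lintegral_const_mul _ hρm, hmass, mul_one,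
          ENNReal.ofReal_mul (exp_pos _).le, ENNReal.ofReal_pow (norm_nonneg _), ofReal_norm]

theorem exists_contDiffBump_sequence (N : ℕ) :
    ∃ b : ℕ → ContDiffBump (0 : EuclideanSpace ℝ (Fin N)),
      Tendsto (fun n => (b n).rOut) atTop (nhds 0) ∧ (∀ n, (b n).rOut ≤ 2 * (b n).rIn) ∧
        ∀ n : ℕ, n * (b n).rOut + (b n).rOut ^ 2 / 2 ≤ 2 := by
  have hpos : ∀ n : ℕ, (0 : ℝ) < 1 / (n + 1) := fun n => by positivity
  refine ⟨fun n => ⟨1 / (n + 1) / 2, 1 / (n + 1), half_pos (hpos n), half_lt_self (hpos n)⟩,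
    tendsto_one_div_add_atTop_nhds_zero_nat, fun n => by simp only; linarith, fun n => ?_⟩
  have h1 : (n : ℝ) * (1 / (n + 1)) + 1 / (n + 1) = 1 := by field_simp
  have h2 : (0 : ℝ) ≤ n * (1 / (n + 1)) := by positivity
  have h3 := hpos n
  simp only
  nlinarith

theorem HasWeakGradient.exists_lintegral_gaussian_sub_sq_le (N : ℕ) :
    ∃ C : ℝ≥0∞, C ≠ ⊤ ∧ ∀ (ψ : EuclideanSpace ℝ (Fin N) → ℝ)
      (g : EuclideanSpace ℝ (Fin N) → EuclideanSpace ℝ (Fin N)), HasWeakGradient N ψ g →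
      ∫⁻ p : EuclideanSpace ℝ (Fin N) × EuclideanSpace ℝ (Fin N),
          ENNReal.ofReal (exp (-(‖p.1‖ ^ 2 + ‖p.2‖ ^ 2) / 2) *
            ((1 + (‖p.1‖ ^ 2 + ‖p.2‖ ^ 2)) * (ψ p.1 - ψ p.2) ^ 2)) ≤
        C * ∫⁻ x, ENNReal.ofReal (exp (-‖x‖ ^ 2 / 2) * ‖g x‖ ^ 2) := by
  obtain ⟨C, hC, hsmooth⟩ := exists_lintegral_ball_gaussian_sub_sq_le (EuclideanSpace ℝ (Fin N))
  refine ⟨C * ENNReal.ofReal (exp 2), by finiteness, fun ψ g h => ?_⟩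
  obtain ⟨b, hb0, hbK, hbR⟩ := exists_contDiffBump_sequence N
  let f : ℕ → EuclideanSpace ℝ (Fin N) → ℝ := fun n =>
    (b n).normed volume ⋆[ContinuousLinearMap.lsmul ℝ ℝ, volume] ψ
  have hf : ∀ n, ContDiff ℝ 1 (f n) := fun n =>
    (b n).hasCompactSupport_normed.contDiff_convolution_left (n := 1) _ (b n).contDiff_normed h.1
  have hlim : ∀ᵐ x, Tendsto (fun n => f n x) atTop (nhds (ψ x)) :=
    ContDiffBump.ae_convolution_tendsto_right_of_locallyIntegrable hb0
      (Eventually.of_forall hbK) h.1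
  let H : (EuclideanSpace ℝ (Fin N) → ℝ) →
      EuclideanSpace ℝ (Fin N) × EuclideanSpace ℝ (Fin N) → ℝ≥0∞ := fun u p =>
    ENNReal.ofReal (exp (-(‖p.1‖ ^ 2 + ‖p.2‖ ^ 2) / 2) *
      ((1 + (‖p.1‖ ^ 2 + ‖p.2‖ ^ 2)) * (u p.1 - u p.2) ^ 2))
  let B : ℕ → Set (EuclideanSpace ℝ (Fin N) × EuclideanSpace ℝ (Fin N)) := fun n =>
    {p | ‖p.1‖ ^ 2 + ‖p.2‖ ^ 2 ≤ (n : ℝ) ^ 2}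
  have hBm : ∀ n, MeasurableSet (B n) := fun n =>
    measurableSet_le (by fun_prop) measurable_const
  have hmeas : ∀ n, Measurable ((B n).indicator (H (f n))) := fun n => by
    have := (hf n).continuous.measurable
    exact Measurable.indicator (by fun_prop) (hBm n)
  have hbound : ∀ n, ∫⁻ p, (B n).indicator (H (f n)) p ≤ C * ENNReal.ofReal (exp 2) *
      ∫⁻ x, ENNReal.ofReal (exp (-‖x‖ ^ 2 / 2) * ‖g x‖ ^ 2) := fun n => by
    rw [lintegral_indicator (hBm n), mul_assoc]
    refine (hsmooth (f n) n (hf n) n.cast_nonneg).trans ?_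
    gcongr
    exact h.lintegral_gaussian_fderiv_convolution_le (b n) (hbR n)
  have hconv : ∀ᵐ p : EuclideanSpace ℝ (Fin N) × EuclideanSpace ℝ (Fin N),
      Tendsto (fun n => (B n).indicator (H (f n)) p) atTop (nhds (H ψ p)) := by
    rw [Measure.volume_eq_prod]
    filter_upwards [Measure.quasiMeasurePreserving_fst.ae hlim,
      Measure.quasiMeasurePreserving_snd.ae hlim] with p h1 h2
    have hH : Tendsto (fun n => H (f n) p) atTop (nhds (H ψ p)) :=
      ENNReal.tendsto_ofReal ((((h1.sub h2).pow 2).const_mul _).const_mul _)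
    refine hH.congr' ?_
    have hsq : Tendsto (fun n : ℕ => (n : ℝ) ^ 2) atTop atTop :=
      (tendsto_pow_atTop two_ne_zero).comp tendsto_natCast_atTop_atTop
    filter_upwards [hsq.eventually_ge_atTop (‖p.1‖ ^ 2 + ‖p.2‖ ^ 2)] with n hn
    exact (Set.indicator_of_mem (show p ∈ B n from hn) _).symm
  calc ∫⁻ p, H ψ p = ∫⁻ p, liminf (fun n => (B n).indicator (H (f n)) p) atTop :=
        lintegral_congr_ae (hconv.mono fun p hp => hp.liminf_eq.symm)
    _ ≤ liminf (fun n => ∫⁻ p, (B n).indicator (H (f n)) p) atTop := lintegral_liminf_le hmeas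
    _ ≤ liminf (fun _ : ℕ => C * ENNReal.ofReal (exp 2) *
          ∫⁻ x, ENNReal.ofReal (exp (-‖x‖ ^ 2 / 2) * ‖g x‖ ^ 2)) atTop :=
        liminf_le_liminf (Eventually.of_forall hbound)
    _ = _ := liminf_const _

theorem iInf_lintegral_gaussian_mul_le {E : Type*} [NormedAddCommGroup E] [InnerProductSpace ℝ E]
    [FiniteDimensional ℝ E] [MeasurableSpace E] [BorelSpace E] {ψ : E → ℝ}
    (hψ : AEStronglyMeasurable ψ) :
    (∫⁻ y : E, ENNReal.ofReal (exp (-‖y‖ ^ 2 / 2))) *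
        ⨅ c : ℝ, ∫⁻ x, ENNReal.ofReal ((1 + ‖x‖ ^ 2) * exp (-‖x‖ ^ 2 / 2) * (ψ x - c) ^ 2) ≤
      ∫⁻ p : E × E, ENNReal.ofReal (exp (-(‖p.1‖ ^ 2 + ‖p.2‖ ^ 2) / 2) *
        ((1 + (‖p.1‖ ^ 2 + ‖p.2‖ ^ 2)) * (ψ p.1 - ψ p.2) ^ 2)) := by
  have h1 : AEMeasurable (fun p : E × E => ψ p.1) (volume.prod volume) :=
    hψ.aemeasurable.comp_fst
  have h2 : AEMeasurable (fun p : E × E => ψ p.2) (volume.prod volume) :=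
    hψ.aemeasurable.comp_snd
  rw [Measure.volume_eq_prod, lintegral_prod_symm _ (by fun_prop),
    ← lintegral_mul_const _ (by fun_prop)]
  refine lintegral_mono fun y => ?_
  refine (mul_le_mul' le_rfl (iInf_le _ (ψ y))).trans ?_
  rw [← lintegral_const_mul' _ _ ENNReal.ofReal_ne_top]
  refine lintegral_mono fun x => ?_
  rw [← ENNReal.ofReal_mul (exp_pos _).le]
  refine ENNReal.ofReal_le_ofReal ?_
  have hexp : exp (-(‖x‖ ^ 2 + ‖y‖ ^ 2) / 2) = exp (-‖x‖ ^ 2 / 2) * exp (-‖y‖ ^ 2 / 2) := by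
    rw [← Real.exp_add]
    ring_nf
  calc exp (-‖y‖ ^ 2 / 2) * ((1 + ‖x‖ ^ 2) * exp (-‖x‖ ^ 2 / 2) * (ψ x - ψ y) ^ 2)
      = exp (-(‖x‖ ^ 2 + ‖y‖ ^ 2) / 2) * ((1 + ‖x‖ ^ 2) * (ψ x - ψ y) ^ 2) := by
        rw [hexp]
        ring
    _ ≤ _ := by
        gcongr
        exact le_add_of_nonneg_right (sq_nonneg _)

end

/-- Gaussian Poincaré inequality with strengthened weight: there is `C > 0`
depending only on `N ≥ 1` such that for every locally integrable `ψ` with weak gradient `g`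
satisfying `∫ e^{-|x|²/2}|g|² dx < ∞`,
`inf_{c ∈ ℝ} ∫ (1+|x|²) e^{-|x|²/2} (ψ - c)² dx ≤ C ∫ e^{-|x|²/2} |g|² dx`. -/
theorem stmt8 (N : ℕ) (hN : 1 ≤ N) :
    ∃ C : ℝ, 0 < C ∧
      ∀ (ψ : EuclideanSpace ℝ (Fin N) → ℝ)
        (g : EuclideanSpace ℝ (Fin N) → EuclideanSpace ℝ (Fin N)),
        HasWeakGradient N ψ g →
        (∫⁻ x, ENNReal.ofReal (Real.exp (-‖x‖ ^ 2 / 2) * ‖g x‖ ^ 2)) < ⊤ →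
        (⨅ c : ℝ, ∫⁻ x,
            ENNReal.ofReal ((1 + ‖x‖ ^ 2) * Real.exp (-‖x‖ ^ 2 / 2) * (ψ x - c) ^ 2))
          ≤ ENNReal.ofReal C *
              ∫⁻ x, ENNReal.ofReal (Real.exp (-‖x‖ ^ 2 / 2) * ‖g x‖ ^ 2) := by
  obtain ⟨C, hC, hmain⟩ := HasWeakGradient.exists_lintegral_gaussian_sub_sq_le N
  set Z : ℝ≥0∞ := ∫⁻ y : EuclideanSpace ℝ (Fin N), ENNReal.ofReal (exp (-‖y‖ ^ 2 / 2)) with hZ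
  have hZtop : Z ≠ ⊤ := ne_top_of_le_ne_top
    (lintegral_one_add_sq_mul_gaussian_lt_top (EuclideanSpace ℝ (Fin N))).ne
    (lintegral_mono fun y => ENNReal.ofReal_le_ofReal
      (le_mul_of_one_le_left (exp_pos _).le (by nlinarith [sq_nonneg ‖y‖])))
  have hZ0 : Z ≠ 0 := by
    rw [hZ, ← pos_iff_ne_zero, lintegral_pos_iff_support (by fun_prop)]
    have : Function.support (fun y : EuclideanSpace ℝ (Fin N) =>
        ENNReal.ofReal (exp (-‖y‖ ^ 2 / 2))) = Set.univ :=
      Set.eq_univ_of_forall fun y => (ENNReal.ofReal_pos.2 (exp_pos _)).ne'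
    rw [this]
    exact Measure.measure_univ_pos.2 (NeZero.ne _)
  have hfin : Z⁻¹ * C ≠ ⊤ := ENNReal.mul_ne_top (ENNReal.inv_ne_top.2 hZ0) hC
  refine ⟨(Z⁻¹ * C).toReal + 1, by positivity, fun ψ g h _ => ?_⟩
  have hle := (iInf_lintegral_gaussian_mul_le h.1.aestronglyMeasurable).trans (hmain ψ g h)
  calc _ ≤ Z⁻¹ * (C * ∫⁻ x, ENNReal.ofReal (exp (-‖x‖ ^ 2 / 2) * ‖g x‖ ^ 2)) :=
        (ENNReal.mul_le_iff_le_inv hZ0 hZtop).1 hle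
    _ = ENNReal.ofReal (Z⁻¹ * C).toReal *
          ∫⁻ x, ENNReal.ofReal (exp (-‖x‖ ^ 2 / 2) * ‖g x‖ ^ 2) := by
        rw [ENNReal.ofReal_toReal hfin, mul_assoc]
    _ ≤ _ := by
        gcongr
        linarith
end
end
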